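/- arXiv:1011.4598 — 8 statements merged into one kernel-verified Lean document; each statement's English description precedes it below -/
import Mathlib

section
/- Let n ≥ 1, K ≥ 1, let A_1 and B_1 be n×n Hermitian positive definite complex matrices, and for each i ∈ {2,…,K} let A_i and B_i be n×n Hermitian positive semidefinite complex matrices. Then the quantity ∑_{i=1}^{K} Tr{(A_i − B_i)[(∑_{j=1}^{i} B_j)^{-1} − (∑_{j=1}^{i} A_j)^{-1}]} is a real number and is ≥ 0; moreover it equals 0 if and only if A_j = B_j for all j ∈ {1,…,K}. -/
open Matrix
open scoped ComplexOrder

namespace Matrix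

lemma posDef_sum_range_succ {m : Type*} {a : ℕ → Matrix m m ℂ} (h0 : (a 0).PosDef)
    (ha : ∀ i, (a i).PosSemidef) (k : ℕ) : (∑ j ∈ Finset.range (k + 1), a j).PosDef := by
  induction k with
  | zero => simpa using h0
  | succ k ih =>
    rw [Finset.sum_range_succ]
    exact ih.add_posSemidef (ha _)

variable {m : Type*} [Fintype m] [DecidableEq m]

open scoped MatrixOrder in
/-- `Tr(E P E Q) ≥ 0` for positive semidefinite `P`, `Q` and Hermitian `E`. -/
lemma PosSemidef.trace_mul_mul_mul_nonneg {P Q E : Matrix m m ℂ} (hP : P.PosSemidef)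
    (hQ : Q.PosSemidef) (hE : E.IsHermitian) : 0 ≤ (E * P * E * Q).trace := by
  obtain ⟨S, rfl⟩ := CStarAlgebra.nonneg_iff_eq_star_mul_self.mp hQ.nonneg
  have h := (hP.mul_mul_conjTranspose_same (S * E)).trace_nonneg
  rw [conjTranspose_mul, hE.eq] at h
  convert h using 1
  rw [star_eq_conjTranspose, ← Matrix.mul_assoc, trace_mul_comm]
  simp only [Matrix.mul_assoc]

open scoped MatrixOrder in
lemma PosDef.eq_zero_of_trace_mul_mul_mul_eq_zero {P Q E : Matrix m m ℂ} (hP : P.PosDef)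
    (hQ : Q.PosDef) (hE : E.IsHermitian) (h : (E * P * E * Q).trace = 0) : E = 0 := by
  obtain ⟨R, hR, rfl⟩ := CStarAlgebra.isStrictlyPositive_iff_eq_star_mul_self.mp
    hP.isStrictlyPositive
  obtain ⟨S, hS, rfl⟩ := CStarAlgebra.isStrictlyPositive_iff_eq_star_mul_self.mp
    hQ.isStrictlyPositive
  have h' : ((R * E * Sᴴ)ᴴ * (R * E * Sᴴ)).trace = 0 := by
    rw [← h, star_eq_conjTranspose, star_eq_conjTranspose, ← Matrix.mul_assoc _ Sᴴ,
      trace_mul_comm _ S]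
    simp only [conjTranspose_mul, conjTranspose_conjTranspose, hE.eq, Matrix.mul_assoc]
  rw [trace_conjTranspose_mul_self_eq_zero_iff] at h'
  have h1 : R * E = 0 := hS.star.mul_left_eq_zero.mp h'
  exact hR.mul_right_eq_zero.mp h1

/-- Matrix inversion is antitone on positive definite matrices. -/
lemma PosDef.posSemidef_inv_sub_inv {Q C : Matrix m m ℂ} (hQ : Q.PosDef) (hC : C.PosSemidef) :
    (Q⁻¹ - (Q + C)⁻¹).PosSemidef := by
  have hP := hQ.add_posSemidef hC
  have hQu := (isUnit_iff_isUnit_det Q).mp hQ.isUnit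
  have hPu := (isUnit_iff_isUnit_det _).mp hP.isUnit
  have h := (hC.add (hQ.inv.posSemidef.conjTranspose_mul_mul_same C)).conjTranspose_mul_mul_same
    (Q + C)⁻¹
  rw [hP.inv.isHermitian.eq, hC.isHermitian.eq] at h
  have e : C + C * Q⁻¹ * C = (Q + C) * Q⁻¹ * (Q + C) - (Q + C) := by
    simp only [add_mul, mul_add, mul_nonsing_inv _ hQu, nonsing_inv_mul_cancel_right _ _ hQu,
      one_mul]
    abel
  convert h using 1
  rw [e, mul_sub, sub_mul, nonsing_inv_mul _ hPu, one_mul, Matrix.mul_assoc (Q + C),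
    nonsing_inv_mul_cancel_left _ _ hPu, mul_nonsing_inv_cancel_right _ _ hPu]

lemma trace_mul_mul_mul_inv_antitone {X Y C F D : Matrix m m ℂ} (hX : X.PosDef) (hY : Y.PosDef)
    (hC : C.PosSemidef) (hF : F.PosSemidef) (hD : D.IsHermitian) :
    (D * (X + C)⁻¹ * D * (Y + F)⁻¹).trace ≤ (D * X⁻¹ * D * Y⁻¹).trace := by
  have h1 := (hX.posSemidef_inv_sub_inv hC).trace_mul_mul_mul_nonneg
    (hY.add_posSemidef hF).inv.posSemidef hD
  have h2 := hX.inv.posSemidef.trace_mul_mul_mul_nonneg (hY.posSemidef_inv_sub_inv hF) hD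
  rw [← sub_nonneg]
  convert add_nonneg h1 h2 using 1
  rw [← trace_add, ← trace_sub]
  congr 1
  noncomm_ring

/-- Polarization identity for the quadratic form `E ↦ Tr(E X⁻¹ E Y⁻¹)`. -/
lemma two_mul_trace_mul_inv_sub_inv {X Y : Matrix m m ℂ} (hX : IsUnit X) (hY : IsUnit Y)
    (E : Matrix m m ℂ) :
    2 * (E * (Y⁻¹ - X⁻¹)).trace = (E * X⁻¹ * E * Y⁻¹).trace
      + ((X - Y) * X⁻¹ * (X - Y) * Y⁻¹).trace
      - ((X - Y - E) * X⁻¹ * (X - Y - E) * Y⁻¹).trace := by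
  have hXu := (isUnit_iff_isUnit_det X).mp hX
  have hYu := (isUnit_iff_isUnit_det Y).mp hY
  have h1 : X⁻¹ * (X - Y) * Y⁻¹ = Y⁻¹ - X⁻¹ := by
    rw [mul_sub, sub_mul, nonsing_inv_mul _ hXu, mul_nonsing_inv_cancel_right _ _ hYu, one_mul]
  have h2 : Y⁻¹ * (X - Y) * X⁻¹ = Y⁻¹ - X⁻¹ := by
    rw [mul_sub, sub_mul, nonsing_inv_mul _ hYu, mul_nonsing_inv_cancel_right _ _ hXu, one_mul]
  have t1 : (E * (Y⁻¹ - X⁻¹)).trace = (E * X⁻¹ * (X - Y) * Y⁻¹).trace := by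
    rw [← h1]; simp only [Matrix.mul_assoc]
  have t2 : (E * (Y⁻¹ - X⁻¹)).trace = ((X - Y) * X⁻¹ * E * Y⁻¹).trace := by
    rw [← h2, Matrix.mul_assoc Y⁻¹, ← Matrix.mul_assoc E, trace_mul_comm,
      ← Matrix.mul_assoc]
  rw [two_mul]
  nth_rw 1 [t1]
  rw [t2]
  generalize X - Y = D
  rw [← trace_add, ← trace_add, ← trace_sub]
  congr 1
  noncomm_ring

lemma sum_trace_quadratic_le {a b : ℕ → Matrix m m ℂ} (ha0 : (a 0).PosDef) (hb0 : (b 0).PosDef)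
    (ha : ∀ i, (a i).PosSemidef) (hb : ∀ i, (b i).PosSemidef) (X Y : ℕ → Matrix m m ℂ)
    (hX : ∀ k, X k = ∑ j ∈ Finset.range (k + 1), a j)
    (hY : ∀ k, Y k = ∑ j ∈ Finset.range (k + 1), b j) (k : ℕ) :
    ∑ i ∈ Finset.range (k + 1), ((a i - b i) * (X i)⁻¹ * (a i - b i) * (Y i)⁻¹).trace
      + ((X k - Y k) * (X k)⁻¹ * (X k - Y k) * (Y k)⁻¹).trace
      ≤ 2 * ∑ i ∈ Finset.range (k + 1), ((a i - b i) * ((Y i)⁻¹ - (X i)⁻¹)).trace := by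
  have hXp (k) : (X k).PosDef := hX k ▸ posDef_sum_range_succ ha0 ha k
  have hYp (k) : (Y k).PosDef := hY k ▸ posDef_sum_range_succ hb0 hb k
  induction k with
  | zero =>
    have h := two_mul_trace_mul_inv_sub_inv (hXp 0).isUnit (hYp 0).isUnit (a 0 - b 0)
    have hX0 : X 0 = a 0 := by simp [hX]
    have hY0 : Y 0 = b 0 := by simp [hY]
    simp only [zero_add, Finset.sum_range_one, h]
    simp [hX0, hY0]
  | succ k ih =>
    have hXs : X (k + 1) = X k + a (k + 1) := by rw [hX, hX, Finset.sum_range_succ]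
    have hYs : Y (k + 1) = Y k + b (k + 1) := by rw [hY, hY, Finset.sum_range_succ]
    have h := two_mul_trace_mul_inv_sub_inv (hXp (k + 1)).isUnit (hYp (k + 1)).isUnit
      (a (k + 1) - b (k + 1))
    have hD : X (k + 1) - Y (k + 1) - (a (k + 1) - b (k + 1)) = X k - Y k := by
      rw [hXs, hYs]; abel
    have hanti := trace_mul_mul_mul_inv_antitone (hXp k) (hYp k) (ha (k + 1)) (hb (k + 1))
      ((hXp k).isHermitian.sub (hYp k).isHermitian)
    rw [← hXs, ← hYs] at hanti
    rw [hD] at h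
    rw [Finset.sum_range_succ, Finset.sum_range_succ _ (k + 1), mul_add, h]
    rw [← sub_nonneg] at ih hanti ⊢
    convert add_nonneg ih hanti using 1
    ring

/-- The trace inequality for sequences indexed by `ℕ`, with its equality case. -/
lemma sum_trace_sub_mul_inv_sub_inv {a b : ℕ → Matrix m m ℂ} (ha0 : (a 0).PosDef)
    (hb0 : (b 0).PosDef) (ha : ∀ i, (a i).PosSemidef) (hb : ∀ i, (b i).PosSemidef) (k : ℕ)
    (S : ℂ)
    (hS : S = ∑ i ∈ Finset.range (k + 1), ((a i - b i) *
      ((∑ j ∈ Finset.range (i + 1), b j)⁻¹ - (∑ j ∈ Finset.range (i + 1), a j)⁻¹)).trace) :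
    0 ≤ S ∧ (S = 0 → ∀ i ≤ k, a i = b i) := by
  have hXp := posDef_sum_range_succ ha0 ha
  have hYp := posDef_sum_range_succ hb0 hb
  have key := sum_trace_quadratic_le ha0 hb0 ha hb _ _ (fun _ => rfl) (fun _ => rfl) k
  rw [← hS] at key
  have hE (i) : (a i - b i).IsHermitian := (ha i).isHermitian.sub (hb i).isHermitian
  have hnn (i) := (hXp i).inv.posSemidef.trace_mul_mul_mul_nonneg (hYp i).inv.posSemidef (hE i)
  have hlast := (hXp k).inv.posSemidef.trace_mul_mul_mul_nonneg (hYp k).inv.posSemidef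
    ((hXp k).isHermitian.sub (hYp k).isHermitian)
  have hle := (le_add_of_nonneg_right hlast).trans key
  have hsum := Finset.sum_nonneg (s := Finset.range (k + 1)) fun i _ => hnn i
  refine ⟨?_, fun h0 i hi => ?_⟩
  · have h := hsum.trans hle
    rw [Complex.nonneg_iff] at h ⊢
    simpa [eq_comm] using h
  · rw [h0, mul_zero] at hle
    have hz := (Finset.sum_eq_zero_iff_of_nonneg fun i _ => hnn i).mp (le_antisymm hle hsum) i
      (Finset.mem_range.mpr (Nat.lt_succ_of_le hi))
    exact sub_eq_zero.mp
      ((hXp i).inv.eq_zero_of_trace_mul_mul_mul_eq_zero (hYp i).inv (hE i) hz)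

end Matrix

/-- Partial sums of a sequence indexed by `Fin K` are partial sums of its extension by zero. -/
lemma Fin.sum_Iic_eq_sum_range_dite {M : Type*} [AddCommMonoid M] {K : ℕ} (f : Fin K → M)
    (i : Fin K) :
    ∑ j ∈ Finset.Iic i, f j =
      ∑ j ∈ Finset.range (i + 1), if h : j < K then f ⟨j, h⟩ else 0 := by
  rw [Nat.range_succ_eq_Iic, ← Fin.map_valEmbedding_Iic, Finset.sum_map]
  simp

/-- For `A_1, B_1` Hermitian positive definite and `A_i, B_i` (`i ≥ 2`)
Hermitian positive semidefinite `n×n` complex matrices,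
`∑_{i=1}^{K} Tr{(A_i − B_i)[(∑_{j≤i} B_j)⁻¹ − (∑_{j≤i} A_j)⁻¹]}` is real, nonnegative,
and zero iff `A_j = B_j` for all `j`. -/
theorem trace_ineq_partial_sums {n K : ℕ} (hn : 1 ≤ n) (hK : 1 ≤ K)
    (A B : Fin K → Matrix (Fin n) (Fin n) ℂ)
    (hA0 : (A ⟨0, hK⟩).PosDef) (hB0 : (B ⟨0, hK⟩).PosDef)
    (hA : ∀ i : Fin K, i ≠ ⟨0, hK⟩ → (A i).PosSemidef)
    (hB : ∀ i : Fin K, i ≠ ⟨0, hK⟩ → (B i).PosSemidef) :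
    ((∑ i : Fin K, ((A i - B i) *
        ((∑ j ∈ Finset.Iic i, B j)⁻¹ - (∑ j ∈ Finset.Iic i, A j)⁻¹)).trace).im = 0) ∧
    (0 ≤ (∑ i : Fin K, ((A i - B i) *
        ((∑ j ∈ Finset.Iic i, B j)⁻¹ - (∑ j ∈ Finset.Iic i, A j)⁻¹)).trace).re) ∧
    ((∑ i : Fin K, ((A i - B i) *
        ((∑ j ∈ Finset.Iic i, B j)⁻¹ - (∑ j ∈ Finset.Iic i, A j)⁻¹)).trace) = 0 ↔
      ∀ j, A j = B j) := by
  obtain ⟨k, rfl⟩ : ∃ k, K = k + 1 := ⟨K - 1, by omega⟩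
  let ext (f : Fin (k + 1) → Matrix (Fin n) (Fin n) ℂ) (j : ℕ) : Matrix (Fin n) (Fin n) ℂ :=
    if h : j < k + 1 then f ⟨j, h⟩ else 0
  have hext (f) (i : Fin (k + 1)) : ext f i = f i := by
    simp only [ext, i.isLt, dite_true]
  have hpsd (f : Fin (k + 1) → Matrix (Fin n) (Fin n) ℂ) (h0 : (f ⟨0, hK⟩).PosDef)
      (hf : ∀ i, i ≠ ⟨0, hK⟩ → (f i).PosSemidef) (j : ℕ) : (ext f j).PosSemidef := by
    by_cases h : j < k + 1
    · simp only [ext, h, dite_true]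
      by_cases hj : (⟨j, h⟩ : Fin (k + 1)) = ⟨0, hK⟩
      · exact hj ▸ h0.posSemidef
      · exact hf _ hj
    · simpa only [ext, h, dite_false] using PosSemidef.zero
  obtain ⟨hnn, hzero⟩ := sum_trace_sub_mul_inv_sub_inv (a := ext A) (b := ext B)
    (by simpa [ext] using hA0) (by simpa [ext] using hB0) (hpsd A hA0 hA) (hpsd B hB0 hB) k
    (∑ i : Fin (k + 1), ((A i - B i) *
        ((∑ j ∈ Finset.Iic i, B j)⁻¹ - (∑ j ∈ Finset.Iic i, A j)⁻¹)).trace) (by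
      rw [Finset.sum_range]
      refine Finset.sum_congr rfl fun i _ => ?_
      rw [hext, hext, Fin.sum_Iic_eq_sum_range_dite, Fin.sum_Iic_eq_sum_range_dite])
  refine ⟨?_, ?_, fun h j => ?_, fun h => ?_⟩
  · exact (Complex.nonneg_iff.mp hnn).2.symm
  · exact (Complex.nonneg_iff.mp hnn).1
  · simpa only [hext] using hzero h j (Nat.le_of_lt_succ j.isLt)
  · simp [h]
end

section
/- Let A and B be n×n Hermitian positive definite complex matrices. Then Tr{(A − B)(B^{-1} − A^{-1})} is a real number and is ≥ 0, with equality if and only if A = B. -/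
open Matrix
open scoped ComplexOrder

open scoped MatrixOrder Matrix.Norms.L2Operator in
/-- A positive definite matrix factors as `Cᴴ * C` with `C` invertible. -/
theorem Matrix.PosDef.exists_isUnit_eq_conjTranspose_mul_self {n : ℕ}
    {A : Matrix (Fin n) (Fin n) ℂ} (hA : A.PosDef) :
    ∃ C : Matrix (Fin n) (Fin n) ℂ, IsUnit C ∧ A = Cᴴ * C := by
  obtain ⟨C, hC⟩ := CStarAlgebra.nonneg_iff_eq_star_mul_self.mp hA.posSemidef.nonneg
  rw [star_eq_conjTranspose] at hC
  refine ⟨C, ?_, hC⟩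
  have hu := hA.isUnit
  rw [hC, isUnit_iff_isUnit_det, det_mul] at hu
  exact (isUnit_iff_isUnit_det C).mpr (isUnit_of_mul_isUnit_right hu)

/-- `Tr{(A − B)(B⁻¹ − A⁻¹)}` is a squared Frobenius norm of a matrix congruent to `A - B`. -/
theorem Matrix.PosDef.exists_trace_sub_mul_inv_sub_inv_eq {n : ℕ}
    {A B : Matrix (Fin n) (Fin n) ℂ} (hA : A.PosDef) (hB : B.PosDef) :
    ∃ S C : Matrix (Fin n) (Fin n) ℂ, IsUnit S ∧ IsUnit C ∧
      ((A - B) * (B⁻¹ - A⁻¹)).trace = ((S * (A - B) * Cᴴ)ᴴ * (S * (A - B) * Cᴴ)).trace := by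
  obtain ⟨S, hS, hBS⟩ := hB.inv.exists_isUnit_eq_conjTranspose_mul_self
  obtain ⟨C, hC, hAC⟩ := hA.inv.exists_isUnit_eq_conjTranspose_mul_self
  refine ⟨S, C, hS, hC, ?_⟩
  have hD : (A - B)ᴴ = A - B := hA.isHermitian.sub hB.isHermitian
  have hinv : B⁻¹ - A⁻¹ = B⁻¹ * (A - B) * A⁻¹ := by
    rw [mul_sub, sub_mul, mul_assoc, mul_nonsing_inv A ((isUnit_iff_isUnit_det A).mp hA.isUnit),
      nonsing_inv_mul B ((isUnit_iff_isUnit_det B).mp hB.isUnit), mul_one, one_mul]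
  calc ((A - B) * (B⁻¹ - A⁻¹)).trace
      = (((A - B) * Sᴴ * S * (A - B) * Cᴴ) * C).trace := by
        rw [hinv, hBS, hAC]; simp only [mul_assoc]
    _ = (C * ((A - B) * Sᴴ * S * (A - B) * Cᴴ)).trace := trace_mul_comm _ _
    _ = _ := by
        simp only [conjTranspose_mul, conjTranspose_conjTranspose, hD, mul_assoc]

/-- For Hermitian positive definite complex matrices `A`, `B`,
`Tr{(A − B)(B⁻¹ − A⁻¹)}` is real, nonnegative, and zero iff `A = B`. -/
theorem trace_diff_inv_diff_nonneg {n : ℕ}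
    (A B : Matrix (Fin n) (Fin n) ℂ) (hA : A.PosDef) (hB : B.PosDef) :
    (((A - B) * (B⁻¹ - A⁻¹)).trace.im = 0) ∧
    (0 ≤ ((A - B) * (B⁻¹ - A⁻¹)).trace.re) ∧
    (((A - B) * (B⁻¹ - A⁻¹)).trace = 0 ↔ A = B) := by
  obtain ⟨S, C, hS, hC, htr⟩ := hA.exists_trace_sub_mul_inv_sub_inv_eq hB
  have hnonneg := (posSemidef_conjTranspose_mul_self (S * (A - B) * Cᴴ)).trace_nonneg
  rw [htr]
  rw [Complex.nonneg_iff] at hnonneg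
  refine ⟨hnonneg.2.symm, hnonneg.1, ?_⟩
  have hC' : IsUnit Cᴴ := hC.star
  rw [trace_conjTranspose_mul_self_eq_zero_iff, hC'.mul_left_eq_zero, hS.mul_right_eq_zero,
    sub_eq_zero]
end

section
/- Let n ≥ 1, K ≥ 1 and for each r ∈ {1,…,K} let A'_r and A''_r be n×n Hermitian positive semidefinite complex matrices. Then the quantity ∑_{r=1}^{K} Tr{(A''_r − A'_r)[(I + ∑_{s=r}^{K} A'_s)^{-1} − (I + ∑_{s=r}^{K} A''_s)^{-1}]} is a real number and is ≥ 0, with equality if and only if A'_r = A''_r for all r ∈ {1,…,K}. -/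
open Matrix
open scoped ComplexOrder

namespace Matrix

variable {n : Type*} [Fintype n] {X Y S Q D : Matrix n n ℂ}

theorem IsHermitian.star_trace_mul (hS : S.IsHermitian) (hQ : Q.IsHermitian) :
    star (S * Q).trace = (S * Q).trace := by
  rw [← trace_conjTranspose, conjTranspose_mul, hS.eq, hQ.eq, trace_mul_comm]

variable [DecidableEq n]

open scoped MatrixOrder in
theorem PosSemidef.exists_eq_conjTranspose_mul_self (hQ : Q.PosSemidef) :
    ∃ C : Matrix n n ℂ, Q = Cᴴ * C :=
  CStarAlgebra.nonneg_iff_eq_star_mul_self.mp (nonneg_iff_posSemidef.mpr hQ)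

theorem PosSemidef.trace_mul_nonneg (hS : S.PosSemidef) (hQ : Q.PosSemidef) :
    0 ≤ (S * Q).trace := by
  obtain ⟨C, rfl⟩ := hQ.exists_eq_conjTranspose_mul_self
  rw [← Matrix.mul_assoc, trace_mul_comm, ← Matrix.mul_assoc]
  exact (hS.mul_mul_conjTranspose_same C).trace_nonneg

theorem PosSemidef.eq_zero_of_trace_mul_posDef_eq_zero (hS : S.PosSemidef) (hQ : Q.PosDef)
    (h : (S * Q).trace = 0) : S = 0 := by
  obtain ⟨C, hC⟩ := hQ.posSemidef.exists_eq_conjTranspose_mul_self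
  rw [hC, ← Matrix.mul_assoc, trace_mul_comm, ← Matrix.mul_assoc,
    (hS.mul_mul_conjTranspose_same C).trace_eq_zero_iff] at h
  have h' : Q * S * Q = 0 := by
    calc Q * S * Q = Cᴴ * (C * S * Cᴴ) * C := by rw [hC]; noncomm_ring
      _ = 0 := by rw [h]; simp
  rwa [hQ.isUnit.mul_left_eq_zero, hQ.isUnit.mul_right_eq_zero] at h'

theorem PosDef.posSemidef_inv_sub_inv_add (hX : X.PosDef) (hS : S.PosSemidef) :
    (X⁻¹ - (X + S)⁻¹).PosSemidef := by
  have hXS := hX.add_posSemidef hS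
  have e : X⁻¹ - (X + S)⁻¹ = (X + S)⁻¹ * (S + S * X⁻¹ * S) * (X + S)⁻¹ := by
    have h₁ : (X + S)⁻¹ * (X + S) = 1 := nonsing_inv_mul _ ((isUnit_iff_isUnit_det _).mp hXS.isUnit)
    have h₂ : (X + S) * (X + S)⁻¹ = 1 := mul_nonsing_inv _ ((isUnit_iff_isUnit_det _).mp hXS.isUnit)
    have h₃ : X⁻¹ * X = 1 := nonsing_inv_mul _ ((isUnit_iff_isUnit_det _).mp hX.isUnit)
    have h₄ : X * X⁻¹ = 1 := mul_nonsing_inv _ ((isUnit_iff_isUnit_det _).mp hX.isUnit)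
    have h₅ : S + S * X⁻¹ * S = (X + S) * X⁻¹ * (X + S) - (X + S) := by
      simp only [Matrix.add_mul, Matrix.mul_add, h₄, Matrix.mul_assoc, h₃, Matrix.mul_one,
        Matrix.one_mul]
      abel
    rw [h₅, Matrix.mul_sub, Matrix.sub_mul, h₁, Matrix.one_mul, ← Matrix.mul_assoc,
      ← Matrix.mul_assoc, h₁, Matrix.one_mul, Matrix.mul_assoc, h₂, Matrix.mul_one]
  have hi := hXS.inv.isHermitian.eq
  have hm : (S + S * X⁻¹ * S).PosSemidef := by
    have h := hX.inv.posSemidef.conjTranspose_mul_mul_same S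
    rw [hS.isHermitian.eq] at h
    exact hS.add h
  have h := hm.conjTranspose_mul_mul_same (X + S)⁻¹
  rwa [hi, ← e] at h

/-- The quadratic form `D ↦ Re Tr (D X⁻¹ D Y⁻¹)`. -/
noncomputable def invTraceForm (X Y D : Matrix n n ℂ) : ℝ :=
  (D * X⁻¹ * D * Y⁻¹).trace.re

theorem posSemidef_mul_inv_mul (hX : X.PosDef) (hD : D.IsHermitian) :
    (D * X⁻¹ * D).PosSemidef := by
  have h := hX.inv.posSemidef.conjTranspose_mul_mul_same D
  rwa [hD.eq] at h

theorem invTraceForm_nonneg (hX : X.PosDef) (hY : Y.PosDef) (hD : D.IsHermitian) :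
    0 ≤ invTraceForm X Y D :=
  (Complex.le_def.mp ((posSemidef_mul_inv_mul hX hD).trace_mul_nonneg hY.inv.posSemidef)).1

theorem eq_zero_of_invTraceForm_eq_zero (hX : X.PosDef) (hY : Y.PosDef) (hD : D.IsHermitian)
    (h : invTraceForm X Y D = 0) : D = 0 := by
  have hS := posSemidef_mul_inv_mul hX hD
  have h₀ := hS.trace_mul_nonneg hY.inv.posSemidef
  have h₁ : (D * X⁻¹ * D * Y⁻¹).trace = 0 :=
    Complex.ext h (Complex.le_def.mp h₀).2.symm
  have h₂ := hS.eq_zero_of_trace_mul_posDef_eq_zero hY.inv h₁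
  have h₃ : (D * D * X⁻¹).trace = 0 := by
    rw [← trace_mul_cycle, h₂, trace_zero]
  have hDD := posSemidef_conjTranspose_mul_self D
  rw [hD.eq] at hDD
  have h₄ := hDD.eq_zero_of_trace_mul_posDef_eq_zero hX.inv h₃
  rw [← conjTranspose_mul_self_eq_zero, hD.eq, h₄]

theorem invTraceForm_comm (X Y D : Matrix n n ℂ) : invTraceForm X Y D = invTraceForm Y X D := by
  unfold invTraceForm
  rw [Matrix.mul_assoc, trace_mul_comm, ← Matrix.mul_assoc]

theorem invTraceForm_add_right_le (hX : X.PosDef) (hY : Y.PosDef) (hD : D.IsHermitian)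
    (hS : S.PosSemidef) : invTraceForm X (Y + S) D ≤ invTraceForm X Y D := by
  have h := (Complex.le_def.mp ((posSemidef_mul_inv_mul hX hD).trace_mul_nonneg
    (hY.posSemidef_inv_sub_inv_add hS))).1
  rw [Matrix.mul_sub, trace_sub, Complex.sub_re, Complex.zero_re] at h
  exact sub_nonneg.mp h

theorem invTraceForm_add_add_le {S' : Matrix n n ℂ} (hX : X.PosDef) (hY : Y.PosDef)
    (hD : D.IsHermitian) (hS : S.PosSemidef) (hS' : S'.PosSemidef) :
    invTraceForm (X + S) (Y + S') D ≤ invTraceForm X Y D := by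
  refine (invTraceForm_add_right_le (hX.add_posSemidef hS) hY hD hS').trans ?_
  rw [invTraceForm_comm, invTraceForm_comm X]
  exact invTraceForm_add_right_le hY hX hD hS

theorem two_mul_re_trace_mul_inv_sub_inv (hX : X.PosDef) (hY : Y.PosDef)
    (D : Matrix n n ℂ) : 2 * (D * (X⁻¹ - Y⁻¹)).trace.re =
      invTraceForm X Y D + invTraceForm X Y (Y - X) - invTraceForm X Y (Y - X - D) := by
  have hXd := (isUnit_iff_isUnit_det _).mp hX.isUnit
  have hYd := (isUnit_iff_isUnit_det _).mp hY.isUnit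
  have e₁ : X⁻¹ - Y⁻¹ = X⁻¹ * (Y - X) * Y⁻¹ := by
    rw [Matrix.mul_sub, Matrix.sub_mul, Matrix.mul_assoc, mul_nonsing_inv _ hYd,
      nonsing_inv_mul _ hXd, Matrix.mul_one, Matrix.one_mul]
  have e₂ : X⁻¹ - Y⁻¹ = Y⁻¹ * (Y - X) * X⁻¹ := by
    rw [Matrix.mul_sub, Matrix.sub_mul, Matrix.mul_assoc Y⁻¹ X, mul_nonsing_inv _ hXd,
      nonsing_inv_mul _ hYd, Matrix.mul_one, Matrix.one_mul]
  have c₁ : (D * (X⁻¹ - Y⁻¹)).trace = (D * X⁻¹ * (Y - X) * Y⁻¹).trace := by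
    rw [e₁]; simp only [Matrix.mul_assoc]
  have c₂ : (D * (X⁻¹ - Y⁻¹)).trace = ((Y - X) * X⁻¹ * D * Y⁻¹).trace := by
    rw [e₂, Matrix.mul_assoc Y⁻¹, ← Matrix.mul_assoc D, trace_mul_comm]
    simp only [Matrix.mul_assoc]
  generalize Y - X = E at *
  have e : (E - D) * X⁻¹ * (E - D) * Y⁻¹ = E * X⁻¹ * E * Y⁻¹ - E * X⁻¹ * D * Y⁻¹
      - D * X⁻¹ * E * Y⁻¹ + D * X⁻¹ * D * Y⁻¹ := by noncomm_ring
  unfold invTraceForm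
  rw [e, trace_add, trace_sub, trace_sub, ← c₁, ← c₂]
  simp only [Complex.add_re, Complex.sub_re]
  ring

theorem PosDef.one_add_sum {m ι : Type*} [DecidableEq m] (s : Finset ι)
    {A : ι → Matrix m m ℂ} (hA : ∀ i, (A i).PosSemidef) : (1 + ∑ i ∈ s, A i).PosDef :=
  PosDef.one.add_posSemidef (posSemidef_sum s fun i _ ↦ hA i)

theorem sum_invTraceForm_add_le {K : ℕ} (A B : Fin K → Matrix n n ℂ)
    (hA : ∀ r, (A r).PosSemidef) (hB : ∀ r, (B r).PosSemidef) :
    ∑ r, invTraceForm (1 + ∑ s ∈ Finset.Ici r, A s) (1 + ∑ s ∈ Finset.Ici r, B s) (B r - A r) +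
      invTraceForm (1 + ∑ s, A s) (1 + ∑ s, B s) ((1 + ∑ s, B s) - (1 + ∑ s, A s)) ≤
    2 * ∑ r, ((B r - A r) *
      ((1 + ∑ s ∈ Finset.Ici r, A s)⁻¹ - (1 + ∑ s ∈ Finset.Ici r, B s)⁻¹)).trace.re := by
  induction K with
  | zero => simp [invTraceForm]
  | succ K ih =>
    have h := ih (fun r ↦ A r.succ) (fun r ↦ B r.succ) (fun r ↦ hA _) (fun r ↦ hB _)
    have hX := PosDef.one_add_sum Finset.univ fun r : Fin K ↦ hA r.succ
    have hY := PosDef.one_add_sum Finset.univ fun r : Fin K ↦ hB r.succ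
    have hX₀ := PosDef.one_add_sum Finset.univ hA
    have hY₀ := PosDef.one_add_sum Finset.univ hB
    have h₁ := two_mul_re_trace_mul_inv_sub_inv hX₀ hY₀ (B 0 - A 0)
    have h₂ := invTraceForm_add_add_le hX hY (hY.isHermitian.sub hX.isHermitian) (hA 0) (hB 0)
    have hI : Finset.Ici (0 : Fin (K + 1)) = Finset.univ := by ext; simp
    have eA : 1 + ∑ r : Fin K, A r.succ + A 0 = 1 + ∑ r, A r := by
      rw [Fin.sum_univ_succ]; abel
    have eB : 1 + ∑ r : Fin K, B r.succ + B 0 = 1 + ∑ r, B r := by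
      rw [Fin.sum_univ_succ]; abel
    have eD : 1 + ∑ r, B r - (1 + ∑ r, A r) - (B 0 - A 0) =
        1 + ∑ r : Fin K, B r.succ - (1 + ∑ r : Fin K, A r.succ) := by
      rw [← eA, ← eB]; abel
    rw [eA, eB] at h₂
    rw [eD] at h₁
    rw [Fin.sum_univ_succ (n := K), Fin.sum_univ_succ (n := K) (f := fun r ↦ Complex.re _)]
    simp only [Fin.sum_Ici_succ, hI]
    linarith

end Matrix

/-- For Hermitian positive semidefinite `n×n` complex matrices
`A'_r, A''_r`, `r ∈ {1,…,K}`, the quantity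
`∑_{r=1}^{K} Tr{(A''_r − A'_r)[(I + ∑_{s≥r} A'_s)⁻¹ − (I + ∑_{s≥r} A''_s)⁻¹]}`
is real, nonnegative, and zero iff `A'_r = A''_r` for all `r`. -/
theorem trace_ineq_tail_sums {n K : ℕ} (hn : 1 ≤ n) (hK : 1 ≤ K)
    (A' A'' : Fin K → Matrix (Fin n) (Fin n) ℂ)
    (hA' : ∀ r, (A' r).PosSemidef) (hA'' : ∀ r, (A'' r).PosSemidef) :
    ((∑ r : Fin K, ((A'' r - A' r) *
        ((1 + ∑ s ∈ Finset.Ici r, A' s)⁻¹ - (1 + ∑ s ∈ Finset.Ici r, A'' s)⁻¹)).trace).im = 0) ∧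
    (0 ≤ (∑ r : Fin K, ((A'' r - A' r) *
        ((1 + ∑ s ∈ Finset.Ici r, A' s)⁻¹ - (1 + ∑ s ∈ Finset.Ici r, A'' s)⁻¹)).trace).re) ∧
    ((∑ r : Fin K, ((A'' r - A' r) *
        ((1 + ∑ s ∈ Finset.Ici r, A' s)⁻¹ - (1 + ∑ s ∈ Finset.Ici r, A'' s)⁻¹)).trace) = 0 ↔
      ∀ r, A' r = A'' r) := by
  have hX := fun r ↦ PosDef.one_add_sum (Finset.Ici r) hA'
  have hY := fun r ↦ PosDef.one_add_sum (Finset.Ici r) hA''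
  have hD := fun r ↦ (hA'' r).isHermitian.sub (hA' r).isHermitian
  have hsum := sum_invTraceForm_add_le A' A'' hA' hA''
  have hq := fun r ↦ invTraceForm_nonneg (hX r) (hY r) (hD r)
  have hX₀ := PosDef.one_add_sum Finset.univ hA'
  have hY₀ := PosDef.one_add_sum Finset.univ hA''
  have hq₀ := invTraceForm_nonneg hX₀ hY₀ (hY₀.isHermitian.sub hX₀.isHermitian)
  have hqs := Finset.sum_nonneg fun r (_ : r ∈ Finset.univ) ↦ hq r
  refine ⟨?_, ?_, fun h ↦ ?_, fun h ↦ ?_⟩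
  · rw [Complex.im_sum]
    refine Finset.sum_eq_zero fun r _ ↦ Complex.conj_eq_iff_im.mp ?_
    exact (hD r).star_trace_mul ((hX r).inv.isHermitian.sub (hY r).inv.isHermitian)
  · rw [Complex.re_sum]
    linarith
  · have hre := congrArg Complex.re h
    rw [Complex.re_sum, Complex.zero_re] at hre
    have hz := (Finset.sum_eq_zero_iff_of_nonneg fun r _ ↦ hq r).mp (by linarith)
    intro r
    exact (sub_eq_zero.mp (eq_zero_of_invTraceForm_eq_zero (hX r) (hY r) (hD r)
      (hz r (Finset.mem_univ r)))).symm
  · simp [h]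
end

section
/- Let K ≥ 1 and for each k ∈ {1,…,K} let A_k be a nonempty, compact, convex subset of a finite-dimensional real normed vector space E_k, and let u_k : A_1 × … × A_K → ℝ be a function that is continuous on the product A_1 × … × A_K and such that for every fixed choice of a_j ∈ A_j (j ≠ k), the map a_k ↦ u_k(a_1,…,a_K) is concave on A_k. Then there exists a Nash equilibrium: a profile a* with a*_k ∈ A_k for all k such that for every k and every a_k ∈ A_k, u_k(a_k, a*_{-k}) ≤ u_k(a*_k, a*_{-k}). -/
/-- A finset `S` is dominant for a family of rankings `r` if every element is ranked, by at least
one of the rankings, no higher than all the members of `S`. -/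
def IsDominant {I V : Type*} (r : I → V → ℕ) (S : Finset V) : Prop :=
  ∀ y, ∃ i, ∀ x ∈ S, r i y ≤ r i x

/-- The elements ranked above the `l`-th marker `μ l` by every ranking `l` other than `k`. -/
def aboveExcept {I V : Type*} (r : I → V → ℕ) (μ : I → V) (k : I) : Set V :=
  {y | ∀ l, l ≠ k → r l (μ l) < r l y}

section Scarf

variable {I V : Type*} [Fintype I] [DecidableEq I] {r : I → V → ℕ}

theorem IsDominant.exists_minimizers (hr : ∀ i, Function.Injective (r i)) {S : Finset V}
    (hS : IsDominant r S) (hne : S.Nonempty) (hcard : S.card + 1 = Fintype.card I) :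
    ∃ μ : I → V, (∀ i, μ i ∈ S) ∧ (∀ i, ∀ x ∈ S, r i (μ i) ≤ r i x) ∧
      ∃ i j, i ≠ j ∧ (∀ v ∈ S, ∃ l, l ≠ i ∧ μ l = v) ∧ (∀ v ∈ S, ∃ l, l ≠ j ∧ μ l = v) ∧
        μ i = μ j ∧
        ∀ k, Set.InjOn μ {l | l ≠ k} → k = i ∨ k = j := by
  choose μ hμS hμ using fun i => S.exists_min_image (r i) hne
  have hsurj : ∀ v ∈ S, ∃ l, μ l = v := by
    intro v hv
    obtain ⟨l, hl⟩ := hS v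
    exact ⟨l, hr l (le_antisymm (hμ l v hv) (hl _ (hμS l)))⟩
  obtain ⟨i, -, j, -, hij, hμij⟩ := Finset.exists_ne_map_eq_of_card_lt_of_maps_to
    (s := Finset.univ) (t := S) (f := μ) (by rw [Finset.card_univ]; omega) (fun i _ => hμS i)
  refine ⟨μ, hμS, hμ, i, j, hij, ?_, ?_, hμij, ?_⟩
  · intro v hv
    obtain ⟨l, hl⟩ := hsurj v hv
    by_cases h : l = i
    · exact ⟨j, hij.symm, by rw [← hμij, ← h, hl]⟩
    · exact ⟨l, h, hl⟩
  · intro v hv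
    obtain ⟨l, hl⟩ := hsurj v hv
    by_cases h : l = j
    · exact ⟨i, hij, by rw [hμij, ← h, hl]⟩
    · exact ⟨l, h, hl⟩
  · intro k hk
    by_contra! h
    exact hij (hk (Ne.symm h.1) (Ne.symm h.2) hμij)

theorem IsDominant.insert_iff [DecidableEq V] {S : Finset V} (hr : ∀ i, Function.Injective (r i))
    (hS : IsDominant r S) (hcard : S.card + 1 = Fintype.card I) {μ : I → V} (hμS : ∀ i, μ i ∈ S)
    (hμ : ∀ i, ∀ x ∈ S, r i (μ i) ≤ r i x) {x : V} (hx : x ∉ S) :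
    IsDominant r (insert x S) ↔ ∃ k, Set.InjOn μ {l | l ≠ k} ∧ x ∈ aboveExcept r μ k ∧
      ∀ y ∈ aboveExcept r μ k, r k y ≤ r k x := by
  constructor
  · intro h
    obtain ⟨k, hk⟩ := h x
    choose f hf using h
    have hfμ : ∀ v ∈ S, μ (f v) = v := fun v hv =>
      hr _ (le_antisymm (hμ _ v hv) (hf v _ (Finset.mem_insert_of_mem (hμS _))))
    have hfk : ∀ v ∈ S, f v ≠ k := by
      intro v hv hfv
      have h1 := hf v x (Finset.mem_insert_self _ _)
      rw [hfv] at h1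
      have h2 := hr k (le_antisymm h1 (hk v (Finset.mem_insert_of_mem hv)))
      exact hx (h2 ▸ hv)
    have hinj : Set.InjOn f S := fun v hv w hw hvw => by
      rw [← hfμ v hv, ← hfμ w hw, hvw]
    have himg : S.image f = Finset.univ.erase k := by
      apply Finset.eq_of_subset_of_card_le
      · intro l hl
        obtain ⟨v, hv, rfl⟩ := Finset.mem_image.1 hl
        simpa using hfk v hv
      · rw [Finset.card_image_of_injOn hinj, Finset.card_erase_of_mem (Finset.mem_univ _),
          Finset.card_univ]
        omega
    have hfsurj : ∀ l, l ≠ k → f (μ l) = l := by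
      intro l hl
      have : l ∈ S.image f := by simpa [himg] using hl
      obtain ⟨v, hv, rfl⟩ := Finset.mem_image.1 this
      rw [hfμ v hv]
    refine ⟨k, ?_, ?_, ?_⟩
    · intro a ha b hb hab
      rw [← hfsurj a ha, ← hfsurj b hb, hab]
    · intro l hl
      have h1 := hf (μ l) x (Finset.mem_insert_self _ _)
      rw [hfsurj l hl] at h1
      refine lt_of_le_of_ne h1 fun h2 => hx ?_
      rw [← hr l h2]
      exact hμS l
    · intro y hy
      have hl := hf y
      set l := f y
      by_cases hlk : l = k
      · exact hlk ▸ hl x (Finset.mem_insert_self _ _)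
      · exact absurd (hy l hlk) (not_lt.2 (hl _ (Finset.mem_insert_of_mem (hμS l))))
  · rintro ⟨k, -, hxk, hmax⟩ y
    by_cases hy : y ∈ aboveExcept r μ k
    · refine ⟨k, fun z hz => ?_⟩
      obtain rfl | hz := Finset.mem_insert.1 hz
      · exact hmax y hy
      · obtain ⟨l, hl⟩ := hS y
        by_cases hlk : l = k
        · exact hlk ▸ hl z hz
        · exact absurd (hy l hlk) (not_lt.2 (hl _ (hμS l)))
    · simp only [aboveExcept, Set.mem_ofPred_eq, not_forall, not_lt] at hy
      obtain ⟨l, hlk, hl⟩ := hy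
      refine ⟨l, fun z hz => ?_⟩
      obtain rfl | hz := Finset.mem_insert.1 hz
      · exact hl.trans (hxk l hlk).le
      · exact hl.trans (hμ l z hz)

open Classical in
theorem card_filter_maximal {V : Type*} [Fintype V] {f : V → ℕ} (hf : Function.Injective f)
    (M : Set V) :
    (Finset.univ.filter fun x => x ∈ M ∧ ∀ y ∈ M, f y ≤ f x).card = if M.Nonempty then 1 else 0 := by
  split_ifs with h
  · obtain ⟨x, hx, hmax⟩ := Set.exists_max_image M f M.toFinite h
    rw [Finset.card_eq_one]
    refine ⟨x, ?_⟩
    ext z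
    simp only [Finset.mem_filter, Finset.mem_univ, true_and, Finset.mem_singleton]
    constructor
    · rintro ⟨hz, hzm⟩
      exact hf (le_antisymm (hmax z hz) (hzm x hx))
    · rintro rfl
      exact ⟨hx, hmax⟩
  · rw [Set.not_nonempty_iff_eq_empty] at h
    simp [h]

open Classical in
theorem IsDominant.card_extensions [Fintype V] [DecidableEq V]
    (hr : ∀ i, Function.Injective (r i)) {S : Finset V} (hS : IsDominant r S) (hne : S.Nonempty) (hcard : S.card + 1 = Fintype.card I) :
    ∃ μ : I → V, (∀ i, μ i ∈ S) ∧ (∀ i, ∀ x ∈ S, r i (μ i) ≤ r i x) ∧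
      ∃ i j, i ≠ j ∧ μ i = μ j ∧
        (Finset.univ.filter fun x => x ∉ S ∧ IsDominant r (insert x S)).card =
          (if (aboveExcept r μ i).Nonempty then 1 else 0) +
            if (aboveExcept r μ j).Nonempty then 1 else 0 := by
  obtain ⟨μ, hμS, hμ, i, j, hij, hi, hj, hμij, hk⟩ := hS.exists_minimizers hr hne hcard
  refine ⟨μ, hμS, hμ, i, j, hij, hμij, ?_⟩
  have hinj : ∀ k, (∀ v ∈ S, ∃ l, l ≠ k ∧ μ l = v) → Set.InjOn μ {l | l ≠ k} := by
    intro k h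
    have := Finset.injOn_of_surjOn_of_card_le (s := Finset.univ.erase k) (t := S) μ
      (fun l _ => hμS l) (fun v hv => by
        obtain ⟨l, hl, rfl⟩ := h v hv
        exact ⟨l, by simpa using hl, rfl⟩)
      (by rw [Finset.card_erase_of_mem (Finset.mem_univ _), Finset.card_univ]; omega)
    simpa [Set.InjOn] using this
  have hnot : ∀ k, (∀ v ∈ S, ∃ l, l ≠ k ∧ μ l = v) → ∀ x ∈ aboveExcept r μ k, x ∉ S := by
    intro k h x hx hxS
    obtain ⟨l, hl, rfl⟩ := h x hxS
    exact lt_irrefl _ (hx l hl)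
  rw [← card_filter_maximal (hr i), ← card_filter_maximal (hr j), ← Finset.card_union_of_disjoint]
  · congr 1
    ext x
    simp only [Finset.mem_filter, Finset.mem_univ, true_and, Finset.mem_union]
    constructor
    · rintro ⟨hx, hd⟩
      obtain ⟨k, hkinj, h⟩ := (hS.insert_iff hr hcard hμS hμ hx).1 hd
      obtain rfl | rfl := hk k hkinj
      · exact Or.inl h
      · exact Or.inr h
    · rintro (h | h)
      · have hx := hnot i hi x h.1
        exact ⟨hx, (hS.insert_iff hr hcard hμS hμ hx).2 ⟨i, hinj i hi, h⟩⟩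
      · have hx := hnot j hj x h.1
        exact ⟨hx, (hS.insert_iff hr hcard hμS hμ hx).2 ⟨j, hinj j hj, h⟩⟩
  · rw [Finset.disjoint_left]
    intro x hxi hxj
    simp only [Finset.mem_filter, Finset.mem_univ, true_and] at hxi hxj
    obtain ⟨l, hl⟩ := hS x
    refine absurd (hl _ (hμS l)) (not_le.2 ?_)
    by_cases h : l = i
    · exact hxj.1 l (h ▸ hij)
    · exact hxi.1 l h

/-- **Scarf's lemma**: if each ranking `i` has a slack element `s i` that it ranks lowest, and
that the other rankings put above every element that is not slack, then for every colouring with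
`s i` coloured `i` some dominant finset uses every colour exactly once. -/
theorem exists_colorful_isDominant [Fintype V] [Nontrivial I] (hr : ∀ i, Function.Injective (r i))
    (s : I → V) (hlow : ∀ i v, r i (s i) ≤ r i v)
    (hhigh : ∀ i k, k ≠ i → ∀ v ∉ Set.range s, r i v < r i (s k))
    (hT : ∃ v, v ∉ Set.range s) (c : V → I) (hc : ∀ i, c (s i) = i) :
    ∃ S : Finset V, IsDominant r S ∧ S.card = Fintype.card I ∧ S.image c = Finset.univ := by
  classical
  by_contra! hno
  obtain ⟨i₀⟩ : Nonempty I := inferInstance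
  have hI : 1 < Fintype.card I := Fintype.one_lt_card
  have hsinj : Function.Injective s := fun a b h => by rw [← hc a, ← hc b, h]
  set doors : Finset (Finset V) := Finset.univ.filter fun d =>
    IsDominant r d ∧ d.card + 1 = Fintype.card I ∧ d.image c = Finset.univ.erase i₀ with hdoors
  let cofaces : Finset V → Finset V := fun d =>
    Finset.univ.filter fun x => x ∉ d ∧ IsDominant r (insert x d)
  have mem_doors : ∀ d, d ∈ doors ↔
      IsDominant r d ∧ d.card + 1 = Fintype.card I ∧ d.image c = Finset.univ.erase i₀ := by
    simp [hdoors]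
  have mem_cofaces : ∀ d x, x ∈ cofaces d ↔ x ∉ d ∧ IsDominant r (insert x d) := by simp [cofaces]
  have heven : Even (doors.sigma cofaces).card := by
    rw [Finset.card_eq_sum_card_fiberwise (f := fun p => insert p.2 p.1) (t := Finset.univ)
      (fun _ _ => Finset.mem_coe.2 (Finset.mem_univ _))]
    refine Finset.even_sum _ fun R _ => ?_
    obtain h | ⟨⟨d, x⟩, hp⟩ := Finset.eq_empty_or_nonempty
      ((doors.sigma cofaces).filter fun p => insert p.2 p.1 = R)
    · rw [h]; simp
    simp only [Finset.mem_filter, Finset.mem_sigma, mem_doors, mem_cofaces] at hp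
    obtain ⟨⟨⟨hd, hdc, hdi⟩, hxd, hxdom⟩, rfl⟩ := hp
    have hcx : c x ≠ i₀ := by
      intro h
      refine hno _ hxdom (by rw [Finset.card_insert_of_notMem hxd, hdc]) ?_
      rw [Finset.image_insert, hdi, h, Finset.insert_erase (Finset.mem_univ _)]
    have hinj : Set.InjOn c d := by
      rw [← Finset.card_image_iff, hdi, Finset.card_erase_of_mem (Finset.mem_univ _),
        Finset.card_univ]
      omega
    obtain ⟨x', hx', hcx'⟩ := Finset.mem_image.1 (show c x ∈ d.image c by simpa [hdi] using hcx)
    have hxx' : x ≠ x' := fun h => hxd (h ▸ hx')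
    have key : ((doors.sigma cofaces).filter fun p => insert p.2 p.1 = insert x d) =
        {(⟨d, x⟩ : (_ : Finset V) × V), ⟨(insert x d).erase x', x'⟩} := by
      ext ⟨e, z⟩
      simp only [Finset.mem_filter, Finset.mem_sigma, mem_doors, mem_cofaces, Finset.mem_insert,
        Finset.mem_singleton, Sigma.mk.injEq, heq_eq_eq]
      constructor
      · rintro ⟨⟨⟨he, hec, hei⟩, hz, hzd⟩, heq⟩
        have he' : e = (insert x d).erase z := by rw [← heq, Finset.erase_insert hz]
        have hzm : z ∈ insert x d := heq ▸ Finset.mem_insert_self z e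
        by_cases hzx : z = x
        · left
          exact ⟨by rw [he', hzx, Finset.erase_insert hxd], hzx⟩
        · right
          have hzd' : z ∈ d := (Finset.mem_insert.1 hzm).resolve_left hzx
          suffices h : z = x' from ⟨by rw [he', h], h⟩
          by_contra hzx'
          have heinj : Set.InjOn c e := by
            rw [← Finset.card_image_iff, hei, Finset.card_erase_of_mem (Finset.mem_univ _),
              Finset.card_univ]
            omega
          refine hxx' (heinj ?_ ?_ hcx'.symm)
          · simp [he', Ne.symm hzx]
          · simp [he', Ne.symm hzx', hx']
      · have hR : insert x' ((insert x d).erase x') = insert x d :=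
          Finset.insert_erase (Finset.mem_insert_of_mem hx')
        rintro (⟨rfl, rfl⟩ | ⟨rfl, rfl⟩)
        · exact ⟨⟨⟨hd, hdc, hdi⟩, hxd, hxdom⟩, rfl⟩
        · refine ⟨⟨⟨?_, ?_, ?_⟩, Finset.notMem_erase _ _, by rwa [hR]⟩, hR⟩
          · intro y
            obtain ⟨i, hi⟩ := hxdom y
            exact ⟨i, fun w hw => hi w (Finset.mem_of_mem_erase hw)⟩
          · rw [Finset.card_erase_of_mem (Finset.mem_insert_of_mem hx'),
              Finset.card_insert_of_notMem hxd]
            omega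
          · rw [← hdi]
            ext a
            simp only [Finset.mem_image, Finset.mem_erase, Finset.mem_insert]
            constructor
            · rintro ⟨w, ⟨hw, rfl | hwd⟩, rfl⟩
              · exact ⟨_, hx', hcx'⟩
              · exact ⟨w, hwd, rfl⟩
            · rintro ⟨w, hw, rfl⟩
              by_cases h : w = z
              · exact ⟨x, ⟨hxx', Or.inl rfl⟩, by rw [h, hcx']⟩
              · exact ⟨w, ⟨h, Or.inr hw⟩, rfl⟩
    rw [key, Finset.card_pair (by simp [hxx'])]
    exact even_two
  set d₀ : Finset V := (Finset.univ.erase i₀).image s with hd₀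
  have mem_d₀ : ∀ v, v ∈ d₀ ↔ ∃ k, k ≠ i₀ ∧ s k = v := by simp [hd₀]
  have hd₀dom : IsDominant r d₀ := by
    intro y
    by_cases hy : y ∈ Set.range s
    · obtain ⟨k, rfl⟩ := hy
      exact ⟨k, fun x _ => hlow k x⟩
    · refine ⟨i₀, fun x hx => ?_⟩
      obtain ⟨k, hk, rfl⟩ := (mem_d₀ x).1 hx
      exact (hhigh i₀ k hk y hy).le
  have hd₀card : d₀.card + 1 = Fintype.card I := by
    rw [hd₀, Finset.card_image_of_injective _ hsinj, Finset.card_erase_of_mem (Finset.mem_univ _),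
      Finset.card_univ]
    omega
  have hd₀mem : d₀ ∈ doors := by
    refine (mem_doors _).2 ⟨hd₀dom, hd₀card, ?_⟩
    rw [hd₀, Finset.image_image, show c ∘ s = id from funext hc, Finset.image_id]
  have hne : ∀ d : Finset V, d.card + 1 = Fintype.card I → d.Nonempty := fun d h =>
    Finset.card_pos.1 (by omega)
  have hcard₀ : (cofaces d₀).card = 1 := by
    obtain ⟨μ, hμS, hμ, i, j, hij, hμij, h⟩ := hd₀dom.card_extensions hr (hne _ hd₀card) hd₀card
    have hμs : ∀ k, k ≠ i₀ → μ k = s k := fun k hk =>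
      hr k (le_antisymm (hμ k _ ((mem_d₀ _).2 ⟨k, hk, rfl⟩)) (hlow k _))
    obtain ⟨v, hv⟩ := hT
    have hfull : (aboveExcept r μ i₀).Nonempty := by
      refine ⟨v, fun l hl => ?_⟩
      rw [hμs l hl]
      exact lt_of_le_of_ne (hlow l v) fun h => hv ⟨l, hr l h⟩
    have hemp : ∀ p, p ≠ i₀ → μ p = μ i₀ → ¬ (aboveExcept r μ p).Nonempty := by
      rintro p hp hpμ ⟨y, hy⟩
      have h1 := hy i₀ hp.symm
      rw [← hpμ, hμs p hp] at h1
      by_cases hyr : y ∈ Set.range s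
      · obtain ⟨k, rfl⟩ := hyr
        by_cases hkp : k = p
        · exact lt_irrefl _ (hkp ▸ h1)
        · exact absurd (hy k hkp) (not_lt.2 (hlow k _))
      · exact absurd h1 (not_lt.2 (hhigh i₀ p hp y hyr).le)
    change (cofaces d₀).card = _ at h
    rw [h]
    by_cases hi : i = i₀
    · subst hi
      rw [if_pos hfull, if_neg (hemp j hij.symm hμij.symm)]
    · by_cases hj : j = i₀
      · subst hj
        rw [if_pos hfull, if_neg (hemp i hij hμij)]
      · rw [hμs i hi, hμs j hj] at hμij
        exact absurd (hsinj hμij) hij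
  have hcard : ∀ d ∈ doors.erase d₀, Even (cofaces d).card := by
    intro d hd
    obtain ⟨hdne, hd⟩ := Finset.mem_erase.1 hd
    obtain ⟨hdom, hdc, hdi⟩ := (mem_doors d).1 hd
    obtain ⟨w, hwd, hw⟩ : ∃ w ∈ d, w ∉ Set.range s := by
      by_contra! hall
      refine hdne (Finset.eq_of_subset_of_card_le (fun v hv => ?_) (by omega))
      obtain ⟨k, rfl⟩ := hall v hv
      refine (mem_d₀ _).2 ⟨k, ?_, rfl⟩
      have := Finset.mem_image_of_mem c hv
      rw [hdi, hc] at this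
      exact Finset.ne_of_mem_erase this
    obtain ⟨μ, hμS, hμ, i, j, hij, hμij, h⟩ := hdom.card_extensions hr (hne _ hdc) hdc
    have hfull : ∀ k, (aboveExcept r μ k).Nonempty := fun k =>
      ⟨s k, fun l hl => (hμ l w hwd).trans_lt (hhigh l k hl.symm w hw)⟩
    change (cofaces d).card = _ at h
    rw [h, if_pos (hfull i), if_pos (hfull j)]
    exact even_two
  rw [Finset.card_sigma, ← Finset.add_sum_erase _ _ hd₀mem, hcard₀, Nat.even_add] at heven
  exact Nat.not_even_one (heven.2 (Finset.even_sum _ hcard))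

end Scarf

open Filter Topology

/-- A Sperner-type lemma: for every colouring of the lattice points of a dilated simplex there is
a lattice point `q` such that every colour `i` with `q i` large occurs close to `q`. -/
theorem exists_lattice_cluster {I : Type*} [Fintype I] [Nontrivial I] (N : ℕ)
    (c : (I → ℕ) → I) :
    ∃ q : I → ℕ, ∑ i, q i = N ∧ ∀ i, Fintype.card I ≤ q i →
      ∃ p : I → ℕ, ∑ i, p i = N ∧ c p = i ∧
        ∀ k, p k ≤ q k + Fintype.card I ∧ q k ≤ p k + Fintype.card I := by
  classical
  let T := {p : I → Fin (N + 1) // ∑ i, (p i : ℕ) = N}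
  let V := T ⊕ I
  let h : V → I → ℕ := fun v i => Sum.elim (fun p : T => (p.1 i : ℕ) + 1)
    (fun k => if i = k then 0 else N + 2) v
  let e := Fintype.equivFin V
  let M := Fintype.card V
  let r : I → V → ℕ := fun i v => h v i * M + e v
  have he : ∀ v, (e v : ℕ) < M := fun v => (e v).2
  have hlt : ∀ {i v w}, h v i < h w i → r i v < r i w := by
    intro i v w hvw
    have h1 : (h v i + 1) * M ≤ h w i * M := Nat.mul_le_mul_right _ hvw
    have h2 := he v
    simp only [r]
    rw [add_mul] at h1
    omega
  have hle : ∀ {i v w}, r i v ≤ r i w → h v i ≤ h w i := fun hvw =>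
    le_of_not_gt fun hwv => absurd (hlt hwv) (not_lt.2 hvw)
  have hr : ∀ i, Function.Injective (r i) := by
    intro i v w hvw
    have h1 : h v i = h w i := le_antisymm (hle hvw.le) (hle hvw.ge)
    simp only [r, h1] at hvw
    exact e.injective (Fin.ext (by omega))
  have mk : ∀ p : I → ℕ, ∑ i, p i = N → ∃ t : T, ∀ i, (t.1 i : ℕ) = p i := by
    intro p hp
    refine ⟨⟨fun i => ⟨p i, ?_⟩, hp⟩, fun i => rfl⟩
    have := Finset.single_le_sum (f := p) (fun _ _ => Nat.zero_le _) (Finset.mem_univ i)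
    omega
  obtain ⟨i₀⟩ : Nonempty I := inferInstance
  obtain ⟨t₀, -⟩ := mk (Pi.single i₀ N) (by simp)
  obtain ⟨S, hS, -, hSc⟩ := exists_colorful_isDominant hr (fun i => (Sum.inr i : V))
    (fun i v => by
      by_cases hv : v = Sum.inr i
      · rw [hv]
      · refine (hlt ?_).le
        rcases v with p | k
        · simp [h]
        · have : i ≠ k := fun h => hv (by rw [h])
          simp [h, this])
    (fun i k hki v hv => by
      rcases v with p | k'
      · refine hlt ?_
        have := (p.1 i).2
        simp only [h, Sum.elim_inl, Sum.elim_inr, if_neg hki.symm]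
        omega
      · exact absurd ⟨k', rfl⟩ hv)
    ⟨Sum.inl t₀, by simp⟩
    (Sum.elim (fun p => c fun i => p.1 i) id) (fun i => rfl)
  have hcol : ∀ i, Sum.inr i ∈ S ∨ ∃ p : T, Sum.inl p ∈ S ∧ c (fun k => p.1 k) = i := by
    intro i
    obtain ⟨v, hv, hvi⟩ := Finset.mem_image.1 (hSc ▸ Finset.mem_univ i)
    rcases v with p | k
    · exact Or.inr ⟨p, hv, hvi⟩
    · exact Or.inl ((show k = i from hvi) ▸ hv)
  have hdom : ∀ t : T, ∃ i, ∀ x ∈ S, (t.1 i : ℕ) + 1 ≤ h x i := by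
    intro t
    obtain ⟨i, hi⟩ := hS (Sum.inl t)
    exact ⟨i, fun x hx => hle (hi x hx)⟩
  obtain ⟨q, hq⟩ : ∃ q : T, Sum.inl q ∈ S := by
    obtain ⟨i, hi⟩ := hdom t₀
    obtain hs | ⟨p, hp, -⟩ := hcol i
    · have := hi _ hs
      simp [h] at this
    · exact ⟨p, hp⟩
  choose m hmS hm using fun i => S.exists_min_image (fun v => h v i) ⟨_, hq⟩
  have hsum : N < ∑ i, h (m i) i := by
    by_contra! hN
    obtain ⟨t, ht⟩ := mk (fun i => h (m i) i + Pi.single (M := fun _ => ℕ) i₀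
      (N - ∑ i, h (m i) i) i) (by rw [Finset.sum_add_distrib]; simp; omega)
    obtain ⟨i, hi⟩ := hdom t
    have := hi _ (hmS i)
    rw [ht] at this
    omega
  have hclose : ∀ x : T, Sum.inl x ∈ S → ∀ i, (x.1 i : ℕ) + 1 < h (m i) i + Fintype.card I := by
    intro x hx i
    have h1 : ∀ k, h (m k) k ≤ (x.1 k : ℕ) + 1 := fun k => hm k _ hx
    have h2 : ∑ k, ((x.1 k : ℕ) + 1) = N + Fintype.card I := by
      rw [Finset.sum_add_distrib, x.2]; simp
    have h3 := Finset.sum_le_sum fun k (_ : k ∈ Finset.univ.erase i) => h1 k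
    rw [← Finset.add_sum_erase _ _ (Finset.mem_univ i)] at h2 hsum
    omega
  refine ⟨fun i => q.1 i, q.2, fun i hi => ?_⟩
  dsimp only at hi
  obtain hs | ⟨p, hp, hpi⟩ := hcol i
  · have h1 := hclose q hq i
    have h2 : h (m i) i ≤ 0 := by simpa [h] using hm i _ hs
    omega
  · refine ⟨fun i => p.1 i, p.2, hpi, fun k => ?_⟩
    have h1 := hclose q hq k
    have h2 := hclose p hp k
    have h3 : h (m k) k ≤ (p.1 k : ℕ) + 1 := hm k _ hp
    have h4 : h (m k) k ≤ (q.1 k : ℕ) + 1 := hm k _ hq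
    constructor <;> dsimp only <;> omega

/-- Nonlinear complementarity on the simplex: some point of the simplex is supported on the
indices maximizing `g · t`. -/
theorem exists_mem_stdSimplex_support_maximal {I : Type*} [Fintype I] [Nonempty I]
    (g : I → (I → ℝ) → ℝ) (hg : ∀ i, ContinuousOn (g i) (stdSimplex ℝ I)) :
    ∃ t ∈ stdSimplex ℝ I, ∀ i, 0 < t i → ∀ j, g j t ≤ g i t := by
  classical
  obtain hI | hI := subsingleton_or_nontrivial I
  · obtain ⟨i₀⟩ := ‹Nonempty I›
    exact ⟨Pi.single i₀ 1, single_mem_stdSimplex ℝ i₀, fun i _ j => by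
      rw [Subsingleton.elim i j]⟩
  set n := Fintype.card I
  let scale : ℕ → (I → ℕ) → I → ℝ := fun N p i => (p i : ℝ) / (N + 1 : ℕ)
  have hscale : ∀ N p, ∑ i, p i = N + 1 → scale N p ∈ stdSimplex ℝ I := by
    intro N p hp
    refine ⟨fun i => by positivity, ?_⟩
    simp only [scale]
    rw [← Finset.sum_div, ← Nat.cast_sum, hp, div_self (by positivity)]
  choose c hc using fun (x : I → ℝ) => Finite.exists_max fun i => g i x
  have h : ∀ N : ℕ, ∃ q ∈ stdSimplex ℝ I, ∀ i, (n : ℝ) / (N + 1 : ℕ) ≤ q i →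
      ∃ p ∈ stdSimplex ℝ I, (∀ j, g j p ≤ g i p) ∧ dist p q ≤ n / (N + 1 : ℕ) := by
    intro N
    obtain ⟨q, hq, hqp⟩ := exists_lattice_cluster (N + 1) (fun p => c (scale N p))
    refine ⟨scale N q, hscale N q hq, fun i hi => ?_⟩
    obtain ⟨p, hp, hpi, hpq⟩ := hqp i (by
      simp only [scale] at hi
      rw [div_le_div_iff_of_pos_right (by positivity)] at hi
      exact_mod_cast hi)
    refine ⟨scale N p, hscale N p hp, hpi ▸ hc _, ?_⟩
    rw [dist_pi_le_iff (by positivity)]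
    intro k
    simp only [scale]
    rw [Real.dist_eq, ← sub_div, abs_div, abs_of_pos (by positivity : (0 : ℝ) < (N + 1 : ℕ))]
    gcongr
    have h1 : (p k : ℝ) ≤ q k + n := by exact_mod_cast (hpq k).1
    have h2 : (q k : ℝ) ≤ p k + n := by exact_mod_cast (hpq k).2
    rw [abs_le]
    constructor <;> linarith
  choose q hq hqp using h
  obtain ⟨t, ht, φ, hφ, hlim⟩ := (isCompact_stdSimplex ℝ I).tendsto_subseq hq
  refine ⟨t, ht, fun i hi j => ?_⟩
  have hsmall : Tendsto (fun N => (n : ℝ) / (φ N + 1 : ℕ)) atTop (𝓝 0) :=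
    (tendsto_const_div_atTop_nhds_zero_nat (n : ℝ)).comp
      ((tendsto_add_atTop_nat 1).comp hφ.tendsto_atTop)
  have hqi : Tendsto (fun N => q (φ N) i) atTop (𝓝 (t i)) := (tendsto_pi_nhds.1 hlim) i
  have hev : ∀ᶠ N in atTop, ∃ p ∈ stdSimplex ℝ I, (∀ j, g j p ≤ g i p) ∧
      dist p (q (φ N)) ≤ n / (φ N + 1 : ℕ) := by
    filter_upwards [hsmall.eventually_lt hqi hi] with N hN using hqp (φ N) i hN.le
  obtain ⟨N₀, hN₀⟩ := eventually_atTop.1 hev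
  choose! p hp hpmax hpq using hN₀
  have hplim : Tendsto p atTop (𝓝 t) := by
    refine (tendsto_iff_of_dist ?_).2 hlim
    refine squeeze_zero' (Eventually.of_forall fun _ => dist_nonneg) ?_ hsmall
    filter_upwards [eventually_ge_atTop N₀] with N hN using hpq N hN
  have hpw : Tendsto p atTop (𝓝[stdSimplex ℝ I] t) :=
    tendsto_nhdsWithin_iff.2 ⟨hplim, by
      filter_upwards [eventually_ge_atTop N₀] with N hN using hp N hN⟩
  refine le_of_tendsto_of_tendsto ((hg j t ht).tendsto.comp hpw) ((hg i t ht).tendsto.comp hpw) ?_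
  filter_upwards [eventually_ge_atTop N₀] with N hN using hpmax N hN j

/-- **Ky Fan's inequality**. -/
theorem exists_forall_le_zero_of_concaveOn {E : Type*} [AddCommGroup E] [Module ℝ E]
    [TopologicalSpace E] [ContinuousAdd E] [ContinuousSMul ℝ E] [T2Space E] {X : Set E}
    (hne : X.Nonempty) (hcomp : IsCompact X) (hconv : Convex ℝ X) {f : E → E → ℝ}
    (hcont : ∀ y ∈ X, ContinuousOn (fun x => f x y) X)
    (hconc : ∀ x ∈ X, ConcaveOn ℝ X (f x)) (hdiag : ∀ x ∈ X, f x x ≤ 0) :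
    ∃ x ∈ X, ∀ y ∈ X, f x y ≤ 0 := by
  classical
  by_contra! hno
  let F : X → Set E := fun y => {x ∈ X | f x y ≤ 0}
  have hF : ∀ y, IsClosed (F y) := fun y =>
    (hcont y y.2).preimage_isClosed_of_isClosed hcomp.isClosed isClosed_Iic
  obtain ⟨u, hu⟩ := hcomp.elim_finite_subfamily_closed F hF (by
    rw [Set.eq_empty_iff_forall_notMem]
    rintro x ⟨hx, hxF⟩
    obtain ⟨y, hy, hxy⟩ := hno x hx
    exact not_le.2 hxy (Set.mem_iInter.1 hxF ⟨y, hy⟩).2)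
  obtain hu0 | hu0 := u.eq_empty_or_nonempty
  · simp only [hu0, Finset.notMem_empty, Set.iInter_of_empty, Set.iInter_univ,
      Set.inter_univ] at hu
    exact hne.ne_empty hu
  have : Nonempty u := hu0.to_subtype
  let b : (u → ℝ) → E := fun t => ∑ i, t i • (i.1 : E)
  have hb : ∀ t ∈ stdSimplex ℝ u, b t ∈ X := fun t ht =>
    hconv.sum_mem (fun i _ => ht.1 i) ht.2 fun i _ => i.1.2
  have hbc : Continuous b := by fun_prop
  obtain ⟨t, ht, hmax⟩ := exists_mem_stdSimplex_support_maximal (fun (i : u) t => f (b t) i.1)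
    fun i => (hcont _ i.1.2).comp hbc.continuousOn hb
  have hle : ∀ j : u, f (b t) j.1 ≤ 0 := by
    intro j
    calc f (b t) j.1 = ∑ i, t i * f (b t) j.1 := by rw [← Finset.sum_mul, ht.2, one_mul]
      _ ≤ ∑ i, t i * f (b t) i.1 := Finset.sum_le_sum fun i _ => by
        obtain h | h := (ht.1 i).eq_or_lt
        · rw [← h]; simp
        · exact mul_le_mul_of_nonneg_left (hmax i h j) h.le
      _ ≤ f (b t) (b t) := (hconc _ (hb t ht)).le_map_sum (fun i _ => ht.1 i) ht.2 fun i _ => i.1.2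
      _ ≤ 0 := hdiag _ (hb t ht)
  have : b t ∈ X ∩ ⋂ y ∈ u, F y :=
    ⟨hb t ht, Set.mem_iInter₂.2 fun y hy => ⟨hb t ht, hle ⟨y, hy⟩⟩⟩
  rw [hu] at this
  exact this


/-- Rosen's existence theorem: a `K`-player game with nonempty compact
convex strategy sets in finite-dimensional real normed spaces, utilities continuous on the
product of strategy sets and concave in the player's own strategy, has a Nash equilibrium. -/
theorem exists_nash_equilibrium_of_concave_game {K : ℕ} (hK : 1 ≤ K)
    (E : Fin K → Type*)
    [∀ k, NormedAddCommGroup (E k)] [∀ k, NormedSpace ℝ (E k)]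
    [∀ k, FiniteDimensional ℝ (E k)]
    (A : ∀ k, Set (E k))
    (hne : ∀ k, (A k).Nonempty)
    (hcomp : ∀ k, IsCompact (A k))
    (hconv : ∀ k, Convex ℝ (A k))
    (u : Fin K → (∀ k, E k) → ℝ)
    (hcont : ∀ k, ContinuousOn (u k) (Set.univ.pi A))
    (hconc : ∀ k, ∀ a ∈ Set.univ.pi A,
      ConcaveOn ℝ (A k) (fun x => u k (Function.update a k x))) :
    ∃ a : ∀ k, E k, (∀ k, a k ∈ A k) ∧
      ∀ k, ∀ x ∈ A k, u k (Function.update a k x) ≤ u k a := by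
  classical
  have hupd : ∀ k, ∀ a ∈ Set.univ.pi A, ∀ x ∈ A k, Function.update a k x ∈ Set.univ.pi A := by
    intro k a ha x hx j _
    by_cases h : j = k
    · subst h; simpa using hx
    · simpa [h] using ha j trivial
  obtain ⟨a, ha, hmax⟩ := exists_forall_le_zero_of_concaveOn (X := Set.univ.pi A)
    (f := fun x y => ∑ k, (u k (Function.update x k (y k)) - u k x))
    (Set.univ_pi_nonempty_iff.2 hne) (isCompact_univ_pi hcomp) (convex_pi fun k _ => hconv k)
    (fun y hy => continuousOn_finsetSum _ fun k _ =>
      ((hcont k).comp (by fun_prop) fun x hx => hupd k x hx _ (hy k trivial)).sub (hcont k))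
    (fun x hx => by
      refine ⟨convex_pi fun k _ => hconv k, fun y hy z hz s t hs ht hst => ?_⟩
      simp only [smul_eq_mul, Finset.mul_sum, ← Finset.sum_add_distrib]
      refine Finset.sum_le_sum fun k _ => ?_
      have h := (hconc k x hx).2 (hy k trivial) (hz k trivial) hs ht hst
      simp only [smul_eq_mul] at h
      simp only [Pi.add_apply, Pi.smul_apply]
      have h1 : s * u k x + t * u k x = u k x := by rw [← add_mul, hst, one_mul]
      linarith)
    (fun x _ => by simp)
  refine ⟨a, fun k => ha k trivial, fun k x hx => ?_⟩
  have h := hmax _ (hupd k a ha x hx)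
  rw [Finset.sum_eq_single k (fun j _ hj => by simp [hj]) (by simp)] at h
  simpa using h
end

section
/- Let K ≥ 1 and for each k ∈ {1,…,K} let A_k be a nonempty, compact, convex subset of ℝ^{m_k}, and let u_k : ℝ^{m_1} × … × ℝ^{m_K} → ℝ be continuous, concave in its k-th argument on A_k for each fixed choice of the other arguments, and differentiable in its k-th argument with gradient ∇_k u_k(a) ∈ ℝ^{m_k} at every profile a ∈ A_1 × … × A_K. Assume the diagonally strict concavity condition: for all profiles a' = (a'_1,…,a'_K) and a'' = (a''_1,…,a''_K) in A_1 × … × A_K with a' ≠ a'', one has ∑_{k=1}^{K} ⟨a''_k − a'_k, ∇_k u_k(a') − ∇_k u_k(a'')⟩ > 0. Then the game has at most one Nash equilibrium. -/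
open scoped RealInnerProductSpace

/-- First-order necessary condition: at a maximizer over a convex set, the gradient has nonpositive
inner product with every feasible direction. -/
theorem IsMaxOn.inner_sub_gradient_nonpos {E : Type*} [NormedAddCommGroup E]
    [InnerProductSpace ℝ E] [CompleteSpace E] {f : E → ℝ} {f' x y : E} {s : Set E}
    (hmax : IsMaxOn f s x) (hs : Convex ℝ s) (hf : HasGradientAt f f' x)
    (hx : x ∈ s) (hy : y ∈ s) : ⟪y - x, f'⟫ ≤ 0 := by
  have h := hmax.localize.hasFDerivWithinAt_nonpos hf.hasFDerivAt.hasFDerivWithinAt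
    (sub_mem_posTangentConeAt_of_segment_subset (hs.segment_subset hx hy))
  rwa [InnerProductSpace.toDual_apply_apply, real_inner_comm] at h

/-- Rosen's uniqueness theorem: under the diagonally strict concavity
condition, a concave game on nonempty compact convex subsets of Euclidean spaces has at
most one Nash equilibrium. -/
theorem nash_equilibrium_unique_of_dsc {K : ℕ} (hK : 1 ≤ K)
    (m : Fin K → ℕ)
    (A : ∀ k, Set (EuclideanSpace ℝ (Fin (m k))))
    (hne : ∀ k, (A k).Nonempty)
    (hcomp : ∀ k, IsCompact (A k))
    (hconv : ∀ k, Convex ℝ (A k))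
    (u : Fin K → (∀ k, EuclideanSpace ℝ (Fin (m k))) → ℝ)
    (hcont : ∀ k, Continuous (u k))
    (hconc : ∀ k, ∀ a : ∀ j, EuclideanSpace ℝ (Fin (m j)),
      ConcaveOn ℝ (A k) (fun x => u k (Function.update a k x)))
    (g : ∀ k, (∀ j, EuclideanSpace ℝ (Fin (m j))) → EuclideanSpace ℝ (Fin (m k)))
    (hgrad : ∀ k, ∀ a ∈ Set.univ.pi A,
      HasGradientAt (fun x => u k (Function.update a k x)) (g k a) (a k))
    (hdsc : ∀ a' a'' : ∀ j, EuclideanSpace ℝ (Fin (m j)),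
      a' ∈ Set.univ.pi A → a'' ∈ Set.univ.pi A → a' ≠ a'' →
      0 < ∑ k, ⟪a'' k - a' k, g k a' - g k a''⟫) :
    ∀ a b : ∀ j, EuclideanSpace ℝ (Fin (m j)),
      ((∀ k, a k ∈ A k) ∧ ∀ k, ∀ x ∈ A k, u k (Function.update a k x) ≤ u k a) →
      ((∀ k, b k ∈ A k) ∧ ∀ k, ∀ x ∈ A k, u k (Function.update b k x) ≤ u k b) →
      a = b := by
  rintro a b ⟨haA, ha⟩ ⟨hbA, hb⟩
  by_contra hab
  have haA' : a ∈ Set.univ.pi A := fun k _ => haA k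
  have hbA' : b ∈ Set.univ.pi A := fun k _ => hbA k
  refine (hdsc a b haA' hbA' hab).not_ge (Finset.sum_nonpos fun k _ => ?_)
  have hamax : IsMaxOn (fun x => u k (Function.update a k x)) (A k) (a k) := fun x hx => by
    simpa using ha k x hx
  have hbmax : IsMaxOn (fun x => u k (Function.update b k x)) (A k) (b k) := fun x hx => by
    simpa using hb k x hx
  have h₁ := hamax.inner_sub_gradient_nonpos (hconv k) (hgrad k a haA') (haA k) (hbA k)
  have h₂ := hbmax.inner_sub_gradient_nonpos (hconv k) (hgrad k b hbA') (hbA k) (haA k)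
  rw [← neg_sub, inner_neg_left] at h₂
  rw [inner_sub_right]
  linarith
end

section
/- Let K ≥ 1, let S be a finite index set, n ≥ 1, and for each player k ∈ {1,…,K} let A_k be a nonempty, compact, convex set of S-indexed tuples (Q_k^{(s)})_{s∈S} of n×n Hermitian complex matrices. Let u_k be a real-valued utility on A_1 × … × A_K that is continuous on the product, concave in the k-th argument, and differentiable in the k-th argument in the sense that there are matrix-valued gradient maps G_k^{(s)} such that for every profile Q and every Hermitian direction tuple (Δ^{(s)})_{s∈S}, the directional derivative of Q_k ↦ u_k(Q_k, Q_{-k}) at Q_k along (Δ^{(s)})_s equals ∑_{s∈S} Re Tr(G_k^{(s)}(Q) Δ^{(s)}). Assume the matrix diagonally strict concavity condition: for all profiles Q' ≠ Q'' in A_1 × … × A_K, ∑_{s∈S} ∑_{k=1}^{K} Re Tr{(Q_k^{(s)''} − Q_k^{(s)'})(G_k^{(s)}(Q') − G_k^{(s)}(Q''))} > 0. Then the game has at most one Nash equilibrium. -/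
open Matrix

/-- A function on `ℝ` whose restriction to `[0, 1]` is maximal at `0` has nonpositive derivative
there. -/
theorem HasDerivAt.nonpos_of_forall_le_zero {f : ℝ → ℝ} {f' : ℝ} (hf : HasDerivAt f f' 0)
    (hmax : ∀ t ∈ Set.Icc (0 : ℝ) 1, f t ≤ f 0) : f' ≤ 0 := by
  refine le_of_tendsto hf.tendsto_slope_zero_right ?_
  filter_upwards [Ioc_mem_nhdsGT (zero_lt_one' ℝ)] with t ht
  rw [zero_add, smul_eq_mul]
  exact mul_nonpos_of_nonneg_of_nonpos (inv_nonneg.2 ht.1.le)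
    (sub_nonpos.2 (hmax t ⟨ht.1.le, ht.2⟩))

/-- First-order optimality over a convex strategy set: the directional derivative from a best
response `Q k` towards any other strategy `X` is nonpositive. -/
theorem deriv_towards_nonpos_of_best_response {ι E : Type*} [DecidableEq ι] [AddCommGroup E]
    [Module ℝ E] {k : ι} {C : Set E} (hC : Convex ℝ C) {v : (ι → E) → ℝ} {Q : ι → E}
    (hQ : Q k ∈ C) (hbest : ∀ X ∈ C, v (Function.update Q k X) ≤ v Q) {X : E} (hX : X ∈ C)
    {d : ℝ} (hd : HasDerivAt (fun t : ℝ => v (Function.update Q k (Q k + t • (X - Q k)))) d 0) :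
    d ≤ 0 := by
  refine hd.nonpos_of_forall_le_zero fun t ht => ?_
  simpa using hbest _ (hC.add_smul_sub_mem hQ hX ht)

/-- matrix version of Rosen's uniqueness theorem: under the matrix
diagonally strict concavity condition, a concave game whose strategies are `S`-indexed
tuples of Hermitian `n×n` complex matrices has at most one Nash equilibrium.
The directional-derivative hypothesis encodes that `G k` is the matrix-valued gradient
of `u k` in its `k`-th argument. -/
theorem nash_equilibrium_unique_of_matrix_dsc {K n : ℕ} (hK : 1 ≤ K) (hn : 1 ≤ n)
    (S : Type*) [Fintype S]
    (A : Fin K → Set (S → Matrix (Fin n) (Fin n) ℂ))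
    (hne : ∀ k, (A k).Nonempty)
    (hcomp : ∀ k, IsCompact (A k))
    (hconv : ∀ k, Convex ℝ (A k))
    (hHerm : ∀ k, ∀ Q ∈ A k, ∀ s, (Q s).IsHermitian)
    (u : Fin K → (Fin K → S → Matrix (Fin n) (Fin n) ℂ) → ℝ)
    (hcont : ∀ k, ContinuousOn (u k) (Set.univ.pi A))
    (hconc : ∀ k, ∀ Q ∈ Set.univ.pi A,
      ConcaveOn ℝ (A k) (fun X => u k (Function.update Q k X)))
    (G : Fin K → (Fin K → S → Matrix (Fin n) (Fin n) ℂ) → S → Matrix (Fin n) (Fin n) ℂ)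
    (hgrad : ∀ k, ∀ Q ∈ Set.univ.pi A, ∀ Δ : S → Matrix (Fin n) (Fin n) ℂ,
      (∀ s, (Δ s).IsHermitian) →
      HasDerivAt (fun t : ℝ => u k (Function.update Q k (fun s => Q k s + t • Δ s)))
        (∑ s, ((G k Q s) * (Δ s)).trace.re) (0 : ℝ))
    (hdsc : ∀ Q' Q'' : Fin K → S → Matrix (Fin n) (Fin n) ℂ,
      Q' ∈ Set.univ.pi A → Q'' ∈ Set.univ.pi A → Q' ≠ Q'' →
      0 < ∑ s : S, ∑ k : Fin K,
        ((Q'' k s - Q' k s) * (G k Q' s - G k Q'' s)).trace.re) :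
    ∀ Q R : Fin K → S → Matrix (Fin n) (Fin n) ℂ,
      ((∀ k, Q k ∈ A k) ∧ ∀ k, ∀ X ∈ A k, u k (Function.update Q k X) ≤ u k Q) →
      ((∀ k, R k ∈ A k) ∧ ∀ k, ∀ X ∈ A k, u k (Function.update R k X) ≤ u k R) →
      Q = R := by
  intro Q R ⟨hQ, hQbest⟩ ⟨hR, hRbest⟩
  by_contra hne_QR
  have hopt : ∀ P T : Fin K → S → Matrix (Fin n) (Fin n) ℂ, (∀ k, P k ∈ A k) →
      (∀ k, T k ∈ A k) → (∀ k, ∀ X ∈ A k, u k (Function.update P k X) ≤ u k P) →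
      ∀ k, ∑ s, (G k P s * (T k s - P k s)).trace.re ≤ 0 := by
    intro P T hP hT hbest k
    exact deriv_towards_nonpos_of_best_response (hconv k) (hP k) (hbest k) (hT k)
      (hgrad k P (fun j _ => hP j) (T k - P k)
        fun s => (hHerm k _ (hT k) s).sub (hHerm k _ (hP k) s))
  have hpos := hdsc Q R (fun k _ => hQ k) (fun k _ => hR k) hne_QR
  rw [Finset.sum_comm] at hpos
  refine hpos.not_ge (Finset.sum_nonpos fun k _ => ?_)
  have hsplit : ∀ s, ((R k s - Q k s) * (G k Q s - G k R s)).trace.re =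
      (G k Q s * (R k s - Q k s)).trace.re + (G k R s * (Q k s - R k s)).trace.re := by
    intro s
    rw [Matrix.trace_mul_comm, ← Complex.add_re, ← Matrix.trace_add]
    congr 2
    noncomm_ring
  simp only [hsplit, Finset.sum_add_distrib]
  exact add_nonpos (hopt Q R hQ hR hQbest k) (hopt R Q hR hQ hRbest k)
end

section
/- Fix integers K ≥ 1, n_t ≥ 1, n_r ≥ 1, a real ρ > 0, power budgets P̄_k > 0, and fixed complex n_r×n_t channel matrices H_1,…,H_K such that the stacked n_r×(K n_t) matrix [H_1 … H_K] has rank K n_t (full column rank). For k ∈ {1,…,K} define the strategy set A_k^SUD = {Q : Q is an n_t×n_t Hermitian positive semidefinite complex matrix with Tr(Q) ≤ n_t P̄_k}, and the utility u_k^SUD(Q_1,…,Q_K) = logdet(I + ρ ∑_{ℓ=1}^{K} H_ℓ Q_ℓ H_ℓ^H) − logdet(I + ρ ∑_{ℓ≠k} H_ℓ Q_ℓ H_ℓ^H). Then this K-player game has exactly one Nash equilibrium. -/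
open Matrix
open scoped ComplexOrder

/-- `logdet M = log det M` for a (positive definite Hermitian) complex matrix, whose
determinant is a positive real number. -/
noncomputable def logdet {m : ℕ} (M : Matrix (Fin m) (Fin m) ℂ) : ℝ :=
  Real.log M.det.re

/-- The SUD strategy set of a player with power budget `Pb`: Hermitian positive
semidefinite `nt×nt` matrices with trace at most `nt * Pb`. -/
def SUDset (nt : ℕ) (Pb : ℝ) : Set (Matrix (Fin nt) (Fin nt) ℂ) :=
  {Q | Q.PosSemidef ∧ Q.trace.re ≤ nt * Pb}

/-- The static SUD utility of player `k`:
`logdet(I + ρ ∑_ℓ H_ℓ Q_ℓ H_ℓᴴ) − logdet(I + ρ ∑_{ℓ≠k} H_ℓ Q_ℓ H_ℓᴴ)`. -/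
noncomputable def uSUDstatic {K nt nr : ℕ}
    (ρ : ℝ) (H : Fin K → Matrix (Fin nr) (Fin nt) ℂ) (k : Fin K)
    (Q : Fin K → Matrix (Fin nt) (Fin nt) ℂ) : ℝ :=
  logdet (1 + (ρ : ℂ) • ∑ ℓ : Fin K, H ℓ * Q ℓ * (H ℓ)ᴴ)
    - logdet (1 + (ρ : ℂ) • ∑ ℓ ∈ Finset.univ.filter (fun ℓ => ℓ ≠ k),
        H ℓ * Q ℓ * (H ℓ)ᴴ)

theorem Matrix.PosDef.exists_isUnit_conjTranspose_mul_self {m : ℕ}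
    {M : Matrix (Fin m) (Fin m) ℂ} (hM : M.PosDef) :
    ∃ B : Matrix (Fin m) (Fin m) ℂ, IsUnit B ∧ M = Bᴴ * B := by
  open scoped MatrixOrder in
  obtain ⟨B, hB⟩ := CStarAlgebra.nonneg_iff_eq_star_mul_self.mp hM.posSemidef.nonneg
  have hu := hM.isUnit
  rw [hB] at hu
  exact ⟨B, isUnit_of_mul_isUnit_right hu, hB⟩

theorem Matrix.PosDef.det_re_pos {m : ℕ} {M : Matrix (Fin m) (Fin m) ℂ} (hM : M.PosDef) :
    0 < M.det.re :=
  (Complex.pos_iff.mp hM.det_pos).1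

theorem Matrix.PosDef.logdet_le_trace_sub {m : ℕ} {M : Matrix (Fin m) (Fin m) ℂ}
    (hM : M.PosDef) : logdet M ≤ M.trace.re - m := by
  have hdet : M.det.re = ∏ i, hM.1.eigenvalues i := by
    rw [hM.1.det_eq_prod_eigenvalues, ← RCLike.ofReal_prod]
    exact Complex.ofReal_re _
  have htr : M.trace.re = ∑ i, hM.1.eigenvalues i := by
    rw [hM.1.trace_eq_sum_eigenvalues, ← RCLike.ofReal_sum]
    exact Complex.ofReal_re _
  rw [logdet, hdet, htr, Real.log_prod fun i _ => (hM.eigenvalues_pos i).ne']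
  calc ∑ i, Real.log (hM.1.eigenvalues i)
      ≤ ∑ i, (hM.1.eigenvalues i - 1) :=
        Finset.sum_le_sum fun i _ => Real.log_le_sub_one_of_pos (hM.eigenvalues_pos i)
    _ = _ := by simp

/-- The log-determinant lies below its tangent planes. -/
theorem logdet_sub_logdet_le {m : ℕ} {X Y : Matrix (Fin m) (Fin m) ℂ} (hX : X.PosDef)
    (hY : Y.PosDef) : logdet Y - logdet X ≤ (X⁻¹ * (Y - X)).trace.re := by
  obtain ⟨B, hB, hXB⟩ := hX.inv.exists_isUnit_conjTranspose_mul_self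
  have hZ : (B * Y * Bᴴ).PosDef := hB.posDef_star_right_conjugate_iff.mpr hY
  have hXu : IsUnit X.det := (isUnit_iff_isUnit_det X).mp hX.isUnit
  have htr : (X⁻¹ * (Y - X)).trace = (B * Y * Bᴴ).trace - m := by
    rw [mul_sub, nonsing_inv_mul _ hXu, trace_sub, trace_one, Fintype.card_fin, hXB,
      ← trace_mul_cycle]
  have hdet : Y.det = X.det * (B * Y * Bᴴ).det := by
    have h : (B * Y * Bᴴ).det = (X⁻¹).det * Y.det := by
      rw [hXB]; simp only [det_mul]; ring
    rw [h, ← mul_assoc, ← det_mul, mul_nonsing_inv _ hXu, det_one, one_mul]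
  have hlog : logdet Y = logdet X + logdet (B * Y * Bᴴ) := by
    unfold logdet
    rw [hdet, Complex.mul_re, (Complex.pos_iff.mp hX.det_pos).2.symm, zero_mul, sub_zero,
      Real.log_mul hX.det_re_pos.ne' hZ.det_re_pos.ne']
  have := hZ.logdet_le_trace_sub
  rw [htr, hlog]
  simp only [Complex.sub_re, Complex.natCast_re]
  linarith

/-- First-order optimality of the log-determinant along a segment. -/
theorem trace_inv_mul_re_nonpos_of_logdet_le {m : ℕ} {X D : Matrix (Fin m) (Fin m) ℂ}
    (hX : X.PosDef) (hpos : ∀ t ∈ Set.Ioc (0 : ℝ) 1, (X + (t : ℂ) • D).PosDef)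
    (hle : ∀ t ∈ Set.Ioc (0 : ℝ) 1, logdet (X + (t : ℂ) • D) ≤ logdet X) :
    (X⁻¹ * D).trace.re ≤ 0 := by
  let f : ℝ → Matrix (Fin m) (Fin m) ℂ := fun t => X + (t : ℂ) • D
  have hf : Continuous f := by fun_prop
  have hf0 : f 0 = X := by simp [f]
  have hinv : ContinuousAt (fun t => (f t)⁻¹) 0 := by
    refine ContinuousAt.comp (g := Inv.inv) ?_ hf.continuousAt
    apply continuousAt_matrix_inv
    rw [hf0, Ring.inverse_eq_inv']
    exact continuousAt_inv₀ hX.det_pos.ne'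
  have hlim : Filter.Tendsto (fun t => ((f t)⁻¹ * D).trace.re) (nhdsWithin 0 (Set.Ioi 0))
      (nhds (X⁻¹ * D).trace.re) := by
    have hc : Continuous fun A : Matrix (Fin m) (Fin m) ℂ => (A * D).trace.re := by fun_prop
    have h := (hc.continuousAt.comp hinv).tendsto
    simp only [Function.comp_def, hf0] at h
    exact h.mono_left nhdsWithin_le_nhds
  refine le_of_tendsto hlim ?_
  filter_upwards [Ioc_mem_nhdsGT (zero_lt_one' ℝ)] with t ht
  have h := logdet_sub_logdet_le (hpos t ht) hX
  have hD : X - (X + (t : ℂ) • D) = (-t : ℂ) • D := by rw [neg_smul]; abel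
  rw [hD, mul_smul_comm, trace_smul, smul_eq_mul, ← Complex.ofReal_neg, Complex.re_ofReal_mul]
    at h
  have h1 := hle t ht
  have h2 : 0 ≤ -t * ((f t)⁻¹ * D).trace.re := by
    simp only [f]
    linarith
  have := ht.1
  by_contra! hc
  nlinarith [mul_pos this hc]

/-- Strict monotonicity of `X ↦ -X⁻¹` on positive definite matrices. -/
theorem eq_of_trace_inv_mul_sub_nonpos {m : ℕ} {X Y : Matrix (Fin m) (Fin m) ℂ}
    (hX : X.PosDef) (hY : Y.PosDef) (hXY : (X⁻¹ * (Y - X)).trace.re ≤ 0)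
    (hYX : (Y⁻¹ * (X - Y)).trace.re ≤ 0) : X = Y := by
  obtain ⟨A, hA, hXA⟩ := hX.inv.exists_isUnit_conjTranspose_mul_self
  obtain ⟨B, hB, hYB⟩ := hY.inv.exists_isUnit_conjTranspose_mul_self
  have hXu : IsUnit X.det := (isUnit_iff_isUnit_det X).mp hX.isUnit
  have hYu : IsUnit Y.det := (isUnit_iff_isUnit_det Y).mp hY.isUnit
  have hD : (Y - X)ᴴ = Y - X := hY.1.sub hX.1
  have hsum : X⁻¹ * (Y - X) + Y⁻¹ * (X - Y) = X⁻¹ * (Y - X) * Y⁻¹ * (Y - X) := by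
    have h1 : X⁻¹ * X = 1 := nonsing_inv_mul _ hXu
    have h2 : Y * Y⁻¹ = 1 := mul_nonsing_inv _ hYu
    have h3 : X⁻¹ * (Y - X) * Y⁻¹ = X⁻¹ - Y⁻¹ := by
      rw [mul_sub, sub_mul, mul_assoc, h2, h1, mul_one, one_mul]
    rw [h3, sub_mul, ← neg_sub Y X, mul_neg, ← sub_eq_add_neg]
  have htr : (X⁻¹ * (Y - X) * Y⁻¹ * (Y - X)).trace
      = ((B * (Y - X) * Aᴴ)ᴴ * (B * (Y - X) * Aᴴ)).trace := by
    rw [hXA, hYB]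
    simp only [conjTranspose_mul, conjTranspose_conjTranspose, hD]
    rw [trace_mul_comm (A * ((Y - X) * Bᴴ)) (B * (Y - X) * Aᴴ), mul_assoc (Aᴴ * A),
      mul_assoc Aᴴ, mul_assoc Aᴴ, trace_mul_comm Aᴴ, ← trace_mul_comm (A * _)]
    simp only [mul_assoc]
  have hpsd := (posSemidef_conjTranspose_mul_self (B * (Y - X) * Aᴴ)).trace_nonneg
  have hz : ((B * (Y - X) * Aᴴ)ᴴ * (B * (Y - X) * Aᴴ)).trace = 0 := by
    have h0 := Complex.nonneg_iff.mp hpsd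
    refine Complex.ext (le_antisymm ?_ h0.1) h0.2.symm
    rw [← htr, ← hsum, trace_add, Complex.add_re, Complex.zero_re]
    linarith
  rw [trace_conjTranspose_mul_self_eq_zero_iff] at hz
  have hAs : IsUnit Aᴴ := hA.star
  rw [hAs.mul_left_eq_zero, hB.mul_right_eq_zero] at hz
  exact (sub_eq_zero.mp hz).symm

theorem Matrix.PosSemidef.norm_apply_le_trace {n : ℕ} {Q : Matrix (Fin n) (Fin n) ℂ}
    (hQ : Q.PosSemidef) (i j : Fin n) : ‖Q i j‖ ≤ Q.trace.re := by
  have hdiag : ∀ k, 0 ≤ (Q k k).re ∧ 0 = (Q k k).im := fun k =>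
    Complex.nonneg_iff.mp hQ.diag_nonneg
  have hle : ∀ k, (Q k k).re ≤ Q.trace.re := fun k => by
    rw [trace, Complex.re_sum]
    exact Finset.single_le_sum (f := fun k => (Q k k).re) (fun l _ => (hdiag l).1)
      (Finset.mem_univ k)
  have hdet := (Complex.nonneg_iff.mp (hQ.submatrix ![i, j]).det_nonneg).1
  have hherm : Q j i = star (Q i j) := (hQ.1.apply j i).symm
  simp only [det_fin_two, submatrix_apply, cons_val_zero, cons_val_one, hherm,
    Complex.star_def, Complex.mul_conj, Complex.sub_re, Complex.ofReal_re, Complex.mul_re,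
    ← (hdiag i).2, zero_mul, sub_zero, Complex.normSq_eq_norm_sq] at hdet
  have h0 : 0 ≤ Q.trace.re := (hdiag i).1.trans (hle i)
  refine le_of_sq_le_sq ?_ h0
  nlinarith [mul_le_mul (hle i) (hle j) (hdiag j).1 h0]

theorem Matrix.isClosed_setOf_posSemidef (n : ℕ) :
    IsClosed {Q : Matrix (Fin n) (Fin n) ℂ | Q.PosSemidef} := by
  simp only [posSemidef_iff_dotProduct_mulVec, Set.ofPred_and, Set.ofPred_forall, IsHermitian]
  refine IsClosed.inter (isClosed_eq (by fun_prop) continuous_id)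
    (isClosed_iInter fun x => isClosed_le continuous_const (by fun_prop))

theorem isCompact_SUDset (n : ℕ) (P : ℝ) : IsCompact (SUDset n P) := by
  have hK : IsCompact (Set.univ.pi fun _ : Fin n => Set.univ.pi fun _ : Fin n =>
      Metric.closedBall (0 : ℂ) (n * P)) :=
    isCompact_univ_pi fun _ => isCompact_univ_pi fun _ => isCompact_closedBall _ _
  refine hK.of_isClosed_subset ?_ fun Q hQ i _ j _ => ?_
  · exact (isClosed_setOf_posSemidef n).inter
      (isClosed_le (by fun_prop : Continuous fun Q : Matrix (Fin n) (Fin n) ℂ => Q.trace.re)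
        continuous_const)
  · exact mem_closedBall_zero_iff.mpr ((hQ.1.norm_apply_le_trace i j).trans hQ.2)

theorem SUDset_lineMap_mem {n : ℕ} {P : ℝ} {Q R : Matrix (Fin n) (Fin n) ℂ}
    (hQ : Q ∈ SUDset n P) (hR : R ∈ SUDset n P) {t : ℝ} (ht0 : 0 ≤ t) (ht1 : t ≤ 1) :
    Q + (t : ℂ) • (R - Q) ∈ SUDset n P := by
  have h : Q + (t : ℂ) • (R - Q) = ((1 - t : ℝ) : ℂ) • Q + (t : ℂ) • R := by
    push_cast
    module
  rw [h]
  refine ⟨(hQ.1.smul (Complex.zero_le_real.mpr (sub_nonneg.mpr ht1))).add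
    (hR.1.smul (Complex.zero_le_real.mpr ht0)), ?_⟩
  rw [trace_add, trace_smul, trace_smul, Complex.add_re, smul_eq_mul, smul_eq_mul,
    Complex.re_ofReal_mul, Complex.re_ofReal_mul]
  nlinarith [mul_le_mul_of_nonneg_left hQ.2 (sub_nonneg.mpr ht1),
    mul_le_mul_of_nonneg_left hR.2 ht0]

/-- The covariance matrix of the received signal, whose log-determinant is a potential of the
static SUD game. -/
noncomputable def receivedCov {K nt nr : ℕ} (ρ : ℝ) (H : Fin K → Matrix (Fin nr) (Fin nt) ℂ)
    (Q : Fin K → Matrix (Fin nt) (Fin nt) ℂ) : Matrix (Fin nr) (Fin nr) ℂ :=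
  1 + (ρ : ℂ) • ∑ ℓ : Fin K, H ℓ * Q ℓ * (H ℓ)ᴴ

section Game

variable {K nt nr : ℕ} {ρ : ℝ} {H : Fin K → Matrix (Fin nr) (Fin nt) ℂ}
  {Q R : Fin K → Matrix (Fin nt) (Fin nt) ℂ}

theorem posDef_receivedCov (hρ : 0 < ρ) (hQ : ∀ k, (Q k).PosSemidef) :
    (receivedCov ρ H Q).PosDef :=
  PosDef.one.add_posSemidef <|
    (posSemidef_sum _ fun ℓ _ => (hQ ℓ).mul_mul_conjTranspose_same (H ℓ)).smul
      (Complex.zero_le_real.mpr hρ.le)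

theorem receivedCov_sub : receivedCov ρ H R - receivedCov ρ H Q
    = ∑ k, (ρ : ℂ) • (H k * (R k - Q k) * (H k)ᴴ) := by
  simp only [receivedCov, add_sub_add_left_eq_sub, ← smul_sub, ← Finset.sum_sub_distrib,
    ← Finset.smul_sum, Matrix.mul_sub, Matrix.sub_mul]

theorem receivedCov_update (k : Fin K) (M : Matrix (Fin nt) (Fin nt) ℂ) :
    receivedCov ρ H (Function.update Q k M)
      = receivedCov ρ H Q + (ρ : ℂ) • (H k * (M - Q k) * (H k)ᴴ) := by
  rw [← sub_eq_iff_eq_add', receivedCov_sub, Finset.sum_eq_single k]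
  · simp
  · intro l _ hl
    simp [Function.update_of_ne hl]
  · simp

theorem uSUDstatic_update_le_iff (k : Fin K) (M : Matrix (Fin nt) (Fin nt) ℂ) :
    uSUDstatic ρ H k (Function.update Q k M) ≤ uSUDstatic ρ H k Q ↔
      logdet (receivedCov ρ H (Function.update Q k M)) ≤ logdet (receivedCov ρ H Q) := by
  have h : ∑ ℓ ∈ Finset.univ.filter (fun ℓ => ℓ ≠ k),
        H ℓ * Function.update Q k M ℓ * (H ℓ)ᴴ
      = ∑ ℓ ∈ Finset.univ.filter (fun ℓ => ℓ ≠ k), H ℓ * Q ℓ * (H ℓ)ᴴ :=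
    Finset.sum_congr rfl fun ℓ hℓ => by
      rw [Function.update_of_ne (Finset.mem_filter.mp hℓ).2]
  rw [uSUDstatic, uSUDstatic, h, sub_le_sub_iff_right, receivedCov, receivedCov]

theorem continuousOn_logdet_receivedCov (hρ : 0 < ρ) :
    ContinuousOn (fun Q => logdet (receivedCov ρ H Q)) {Q | ∀ k, (Q k).PosSemidef} := by
  have hc : Continuous fun Q : Fin K → Matrix (Fin nt) (Fin nt) ℂ =>
      (receivedCov ρ H Q).det.re := by
    unfold receivedCov
    fun_prop
  exact hc.continuousOn.log fun Q hQ => (posDef_receivedCov hρ hQ).det_re_pos.ne'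

theorem exists_nash_equilibrium_SUD_static (hρ : 0 < ρ) {P : Fin K → ℝ} (hP : ∀ k, 0 < P k) :
    ∃ Q : Fin K → Matrix (Fin nt) (Fin nt) ℂ, (∀ k, Q k ∈ SUDset nt (P k)) ∧
      ∀ k, ∀ M ∈ SUDset nt (P k),
        uSUDstatic ρ H k (Function.update Q k M) ≤ uSUDstatic ρ H k Q := by
  have hne : (Set.univ.pi fun k => SUDset nt (P k)).Nonempty :=
    ⟨0, fun k _ => ⟨PosSemidef.zero, by
      simpa using mul_nonneg (Nat.cast_nonneg nt) (hP k).le⟩⟩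
  obtain ⟨Q, hQ, hmax⟩ := (isCompact_univ_pi fun k => isCompact_SUDset nt (P k)).exists_isMaxOn
    hne ((continuousOn_logdet_receivedCov (H := H) hρ).mono fun Q hQ k =>
      (hQ k (Set.mem_univ k)).1)
  refine ⟨Q, fun k => hQ k (Set.mem_univ k), fun k M hM => ?_⟩
  rw [uSUDstatic_update_le_iff]
  refine hmax fun l hl => ?_
  by_cases h : l = k
  · subst h
    simpa using hM
  · simpa [Function.update_of_ne h] using hQ l hl

/-- At a Nash equilibrium the potential has no first-order ascent direction. -/
theorem trace_inv_receivedCov_mul_sub_nonpos (hρ : 0 < ρ) {P : Fin K → ℝ}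
    (hQ : ∀ k, Q k ∈ SUDset nt (P k)) (hR : ∀ k, R k ∈ SUDset nt (P k))
    (hNE : ∀ k, ∀ M ∈ SUDset nt (P k),
      uSUDstatic ρ H k (Function.update Q k M) ≤ uSUDstatic ρ H k Q) :
    ((receivedCov ρ H Q)⁻¹ * (receivedCov ρ H R - receivedCov ρ H Q)).trace.re ≤ 0 := by
  rw [receivedCov_sub, Finset.mul_sum, trace_sum, Complex.re_sum]
  refine Finset.sum_nonpos fun k _ => ?_
  have hseg : ∀ t : ℝ, receivedCov ρ H Q + (t : ℂ) • ((ρ : ℂ) • (H k * (R k - Q k) * (H k)ᴴ))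
      = receivedCov ρ H (Function.update Q k (Q k + (t : ℂ) • (R k - Q k))) := fun t => by
    rw [receivedCov_update, add_sub_cancel_left, Matrix.mul_smul, Matrix.smul_mul, smul_comm]
  have hmem : ∀ t ∈ Set.Ioc (0 : ℝ) 1, Q k + (t : ℂ) • (R k - Q k) ∈ SUDset nt (P k) :=
    fun t ht => SUDset_lineMap_mem (hQ k) (hR k) ht.1.le ht.2
  refine trace_inv_mul_re_nonpos_of_logdet_le (posDef_receivedCov hρ fun l => (hQ l).1)
    (fun t ht => ?_) (fun t ht => ?_)
  · rw [hseg]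
    refine posDef_receivedCov hρ fun l => ?_
    by_cases h : l = k
    · subst h
      simpa using (hmem t ht).1
    · simpa [Function.update_of_ne h] using (hQ l).1
  · rw [hseg, ← uSUDstatic_update_le_iff]
    exact hNE k _ (hmem t ht)

theorem Matrix.exists_left_inverse_of_rank_eq_card {m n : Type*} [Fintype m] [Fintype n]
    [DecidableEq n] {A : Matrix m n ℂ} (hA : A.rank = Fintype.card n) :
    ∃ L : Matrix n m ℂ, L * A = 1 := by
  have hinj : Function.Injective A.mulVec := by
    have h := A.mulVecLin.finrank_range_add_finrank_ker
    rw [Module.finrank_fintype_fun_eq_card, ← hA, rank, Nat.add_eq_left,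
      Submodule.finrank_eq_zero, LinearMap.ker_eq_bot] at h
    exact h
  refine ⟨(Aᴴ * A)⁻¹ * Aᴴ, ?_⟩
  rw [Matrix.mul_assoc]
  exact nonsing_inv_mul _
    ((isUnit_iff_isUnit_det _).mp (PosDef.conjTranspose_mul_self A hinj).isUnit)

theorem receivedCov_injective (hρ : 0 < ρ)
    (hrank : (Matrix.of fun (i : Fin nr) (q : Fin K × Fin nt) =>
        H q.1 i q.2).rank = K * nt) :
    Function.Injective (receivedCov ρ H) := by
  intro Q R hQR
  obtain ⟨L, hL⟩ := exists_left_inverse_of_rank_eq_card (hrank.trans (by simp))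
  have hblock : ∀ k l, (Matrix.of fun i j => L (k, i) j) * H l
      = if k = l then (1 : Matrix (Fin nt) (Fin nt) ℂ) else 0 := fun k l => by
    ext i j
    have h := congrFun (congrFun hL (k, i)) (l, j)
    simp only [mul_apply, of_apply, one_apply, Prod.mk.injEq] at h ⊢
    rw [h]
    split_ifs <;> simp_all [one_apply]
  have hsum : ∑ l, H l * (R l - Q l) * (H l)ᴴ = 0 := by
    have h := receivedCov_sub (ρ := ρ) (H := H) (Q := Q) (R := R)
    rw [hQR, sub_self, ← Finset.smul_sum] at h
    exact (smul_eq_zero.mp h.symm).resolve_left (by exact_mod_cast hρ.ne')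
  funext k
  have h := congrArg (fun M => (Matrix.of fun i j => L (k, i) j) * M *
    (Matrix.of fun i j => L (k, i) j)ᴴ) hsum
  simp only [Matrix.mul_sum, Matrix.sum_mul, Matrix.mul_zero, Matrix.zero_mul] at h
  rw [Finset.sum_eq_single k] at h
  · have hk : (H k)ᴴ * (Matrix.of fun i j => L (k, i) j)ᴴ = 1 := by
      rw [← conjTranspose_mul, hblock, if_pos rfl, conjTranspose_one]
    rw [← Matrix.mul_assoc, ← Matrix.mul_assoc, hblock, if_pos rfl, Matrix.one_mul,
      Matrix.mul_assoc, hk, Matrix.mul_one] at h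
    exact (sub_eq_zero.mp h).symm
  · intro l _ hl
    rw [← Matrix.mul_assoc, ← Matrix.mul_assoc, hblock, if_neg (Ne.symm hl)]
    simp
  · simp

end Game

/-- with fixed channel matrices whose horizontal stacking
`[H_1 … H_K]` has full column rank `K·n_t`, the static SUD power allocation game has
exactly one Nash equilibrium. -/
theorem existsUnique_nash_equilibrium_SUD_static {K nt nr : ℕ} (hK : 1 ≤ K)
    (hnt : 1 ≤ nt) (hnr : 1 ≤ nr) (ρ : ℝ) (hρ : 0 < ρ)
    (Pbar : Fin K → ℝ) (hPbar : ∀ k, 0 < Pbar k)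
    (H : Fin K → Matrix (Fin nr) (Fin nt) ℂ)
    (hrank : (Matrix.of fun (i : Fin nr) (q : Fin K × Fin nt) =>
        H q.1 i q.2).rank = K * nt) :
    ∃! Q : Fin K → Matrix (Fin nt) (Fin nt) ℂ,
      (∀ k, Q k ∈ SUDset nt (Pbar k)) ∧
      ∀ k, ∀ R ∈ SUDset nt (Pbar k),
        uSUDstatic ρ H k (Function.update Q k R) ≤ uSUDstatic ρ H k Q := by
  obtain ⟨Q, hQ, hNE⟩ := exists_nash_equilibrium_SUD_static (H := H) hρ hPbar
  refine ⟨Q, ⟨hQ, hNE⟩, fun R ⟨hR, hNE'⟩ => receivedCov_injective hρ hrank ?_⟩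
  exact eq_of_trace_inv_mul_sub_nonpos (posDef_receivedCov hρ fun k => (hR k).1)
    (posDef_receivedCov hρ fun k => (hQ k).1)
    (trace_inv_receivedCov_mul_sub_nonpos hρ hR hQ hNE')
    (trace_inv_receivedCov_mul_sub_nonpos hρ hQ hR hNE)
end

section
/- Let H be a complex n_r×n_t matrix of rank n_t (full column rank), ρ > 0 a real number, and C an n_r×n_r Hermitian positive semidefinite complex matrix. Then the function Q ↦ logdet(I + ρ H Q H^H + C) is strictly concave on the convex set of n_t×n_t Hermitian positive semidefinite complex matrices: for all Hermitian PSD Q' ≠ Q'' and all λ ∈ (0,1), logdet(I + ρ H (λQ' + (1−λ)Q'') H^H + C) > λ logdet(I + ρ H Q' H^H + C) + (1−λ) logdet(I + ρ H Q'' H^H + C). -/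
open Matrix
open scoped ComplexOrder

namespace Matrix

variable {n : Type*} [Fintype n]

theorem mulVec_injective_of_rank_eq_card {m K : Type*} [Field K]
    {H : Matrix m n K} (hrank : H.rank = Fintype.card n) : Function.Injective H.mulVec := by
  have h := LinearMap.finrank_range_add_finrank_ker H.mulVecLin
  rw [Module.finrank_fintype_fun_eq_card, ← hrank] at h
  have hker : Module.finrank K (LinearMap.ker H.mulVecLin) = 0 := by
    rw [Matrix.rank] at h
    omega
  exact LinearMap.ker_eq_bot.mp (Submodule.finrank_eq_zero.mp hker)

variable [DecidableEq n]

theorem PosDef.log_det_re_eq_sum_log_eigenvalues {P : Matrix n n ℂ} (hP : P.PosDef) :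
    Real.log P.det.re = ∑ i, Real.log (hP.isHermitian.eigenvalues i) := by
  have hdet : P.det = ((∏ i, hP.isHermitian.eigenvalues i : ℝ) : ℂ) := by
    rw [Complex.ofReal_prod]
    exact hP.isHermitian.det_eq_prod_eigenvalues
  rw [hdet, Complex.ofReal_re, Real.log_prod fun i _ => (hP.eigenvalues_pos i).ne']

theorem IsHermitian.eq_one_of_eigenvalues_eq_one {P : Matrix n n ℂ} (hP : P.IsHermitian)
    (h : ∀ i, hP.eigenvalues i = 1) : P = 1 := by
  have hdiag : diagonal (RCLike.ofReal ∘ hP.eigenvalues) = (1 : Matrix n n ℂ) := by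
    rw [← diagonal_one]
    congr 1
    ext i
    simp [h i]
  rw [hP.spectral_theorem, hdiag, map_one]

theorem PosDef.log_det_re_lt_trace_sub_card {P : Matrix n n ℂ} (hP : P.PosDef) (hne : P ≠ 1) :
    Real.log P.det.re < P.trace.re - Fintype.card n := by
  have htr : P.trace.re = ∑ i, hP.isHermitian.eigenvalues i := by
    rw [hP.isHermitian.trace_eq_sum_eigenvalues]
    simp
  have hsum : P.trace.re - Fintype.card n = ∑ i, (hP.isHermitian.eigenvalues i - 1) := by
    simp [htr]
  obtain ⟨i, hi⟩ : ∃ i, hP.isHermitian.eigenvalues i ≠ 1 := by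
    by_contra! h
    exact hne (hP.isHermitian.eq_one_of_eigenvalues_eq_one h)
  rw [hP.log_det_re_eq_sum_log_eigenvalues, hsum]
  exact Finset.sum_lt_sum (fun j _ => Real.log_le_sub_one_of_pos (hP.eigenvalues_pos j))
    ⟨i, Finset.mem_univ i, Real.log_lt_sub_one_of_pos (hP.eigenvalues_pos i) hi⟩

open scoped MatrixOrder in
theorem PosDef.exists_isUnit_eq_conjTranspose_mul_self_s13 {M : Matrix n n ℂ} (hM : M.PosDef) :
    ∃ S : Matrix n n ℂ, IsUnit S ∧ M = Sᴴ * S := by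
  obtain ⟨S, hS⟩ := CStarAlgebra.nonneg_iff_eq_star_mul_self.mp hM.posSemidef.nonneg
  rw [star_eq_conjTranspose] at hS
  refine ⟨S, ?_, hS⟩
  have hu := (isUnit_iff_isUnit_det M).mp hM.isUnit
  rw [hS, det_mul] at hu
  exact (isUnit_iff_isUnit_det S).mpr (isUnit_of_mul_isUnit_right hu)

/-- The tangent plane of `log det` at `M` lies strictly above its graph away from `M`. -/
theorem PosDef.log_det_re_lt_add_trace {A M : Matrix n n ℂ} (hA : A.PosDef) (hM : M.PosDef)
    (hne : A ≠ M) :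
    Real.log A.det.re < Real.log M.det.re + ((M⁻¹ * A).trace.re - Fintype.card n) := by
  obtain ⟨S, hS, hMS⟩ := hM.inv.exists_isUnit_eq_conjTranspose_mul_self_s13
  have hMu : IsUnit M.det := (isUnit_iff_isUnit_det M).mp hM.isUnit
  have hSd : IsUnit S.det := (isUnit_iff_isUnit_det S).mp hS
  have hP : (S * A * Sᴴ).PosDef := hS.posDef_star_right_conjugate_iff.mpr hA
  have hP1 : S * A * Sᴴ ≠ 1 := by
    intro h
    have h1 : A * (Sᴴ * S) = 1 := by
      have h2 : S * (A * Sᴴ) = 1 := by rw [← Matrix.mul_assoc, h]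
      have h3 := mul_eq_one_comm.mp h2
      rwa [Matrix.mul_assoc] at h3
    rw [← hMS] at h1
    apply hne
    calc A = A * (M⁻¹ * M) := by rw [nonsing_inv_mul M hMu, Matrix.mul_one]
      _ = M := by rw [← Matrix.mul_assoc, h1, Matrix.one_mul]
  have htr : (S * A * Sᴴ).trace = (M⁻¹ * A).trace := by
    rw [trace_mul_comm, ← Matrix.mul_assoc, ← hMS]
  have hdet : A.det = M.det * (S * A * Sᴴ).det := by
    have h1 : (M * (Sᴴ * S)).det = 1 := by rw [← hMS, mul_nonsing_inv M hMu, det_one]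
    rw [det_mul, det_mul] at h1
    rw [det_mul, det_mul]
    linear_combination (-A.det) * h1
  have hMre := Complex.pos_iff.mp hM.det_pos
  have hPre := Complex.pos_iff.mp hP.det_pos
  have hre : A.det.re = M.det.re * (S * A * Sᴴ).det.re := by
    rw [hdet, Complex.mul_re, ← hMre.2, zero_mul, sub_zero]
  rw [hre, Real.log_mul hMre.1.ne' hPre.1.ne', ← htr]
  linarith [hP.log_det_re_lt_trace_sub_card hP1]

theorem PosDef.log_det_re_strictConcave {A B : Matrix n n ℂ} (hA : A.PosDef) (hB : B.PosDef)
    (hne : A ≠ B) {l : ℝ} (hl0 : 0 < l) (hl1 : l < 1) :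
    l * Real.log A.det.re + (1 - l) * Real.log B.det.re
      < Real.log (l • A + (1 - l) • B).det.re := by
  have hl1' : 0 < 1 - l := sub_pos.mpr hl1
  set M := l • A + (1 - l) • B with hMdef
  have hM : M.PosDef := (hA.smul hl0).add (hB.smul hl1')
  have hAM : A - M = (1 - l) • (A - B) := by rw [hMdef]; module
  have hBM : B - M = l • (B - A) := by rw [hMdef]; module
  have hAne : A ≠ M := by
    rw [← sub_ne_zero, hAM]
    exact smul_ne_zero hl1'.ne' (sub_ne_zero.mpr hne)
  have hBne : B ≠ M := by
    rw [← sub_ne_zero, hBM]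
    exact smul_ne_zero hl0.ne' (sub_ne_zero.mpr hne.symm)
  have htr : l * (M⁻¹ * A).trace.re + (1 - l) * (M⁻¹ * B).trace.re = Fintype.card n := by
    have h1 : M⁻¹ * M = 1 := nonsing_inv_mul M ((isUnit_iff_isUnit_det M).mp hM.isUnit)
    have h2 : (M⁻¹ * (l • A + (1 - l) • B)).trace = Fintype.card n := by
      rw [← hMdef, h1, trace_one]
    have h3 := congrArg Complex.re h2
    simpa only [Matrix.mul_add, Matrix.mul_smul, trace_add, trace_smul, Complex.add_re,
      Complex.smul_re, smul_eq_mul, Complex.natCast_re] using h3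
  have h1 := mul_lt_mul_of_pos_left (hA.log_det_re_lt_add_trace hM hAne) hl0
  have h2 := mul_lt_mul_of_pos_left (hB.log_det_re_lt_add_trace hM hBne) hl1'
  linarith

theorem mul_mul_conjTranspose_injective {m : Type*} [Fintype m] {H : Matrix m n ℂ}
    (hH : Function.Injective H.mulVec) :
    Function.Injective fun Q : Matrix n n ℂ => H * Q * Hᴴ := by
  have hu : IsUnit (Hᴴ * H) := (PosDef.conjTranspose_mul_self H hH).isUnit
  intro X Y hXY
  have h : (Hᴴ * H) * (X * (Hᴴ * H)) = (Hᴴ * H) * (Y * (Hᴴ * H)) := by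
    have := congrArg (fun Z => Hᴴ * Z * H) hXY
    simpa only [Matrix.mul_assoc] using this
  exact hu.mul_right_cancel (hu.mul_left_cancel h)

end Matrix

/-- if `H` has full column rank `n_t`, then
`Q ↦ logdet(I + ρ H Q Hᴴ + C)` is strictly concave on the set of Hermitian positive
semidefinite matrices. -/
theorem logdet_strictConcave {nr nt : ℕ} (H : Matrix (Fin nr) (Fin nt) ℂ)
    (hrank : H.rank = nt) (ρ : ℝ) (hρ : 0 < ρ)
    (C : Matrix (Fin nr) (Fin nr) ℂ) (hC : C.PosSemidef)
    (Q' Q'' : Matrix (Fin nt) (Fin nt) ℂ)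
    (hQ' : Q'.PosSemidef) (hQ'' : Q''.PosSemidef) (hne : Q' ≠ Q'')
    (l : ℝ) (hl0 : 0 < l) (hl1 : l < 1) :
    l * logdet (1 + (ρ : ℂ) • (H * Q' * Hᴴ) + C)
        + (1 - l) * logdet (1 + (ρ : ℂ) • (H * Q'' * Hᴴ) + C)
      < logdet (1 + (ρ : ℂ) • (H * (l • Q' + (1 - l) • Q'') * Hᴴ) + C) := by
  have hinj := mul_mul_conjTranspose_injective
    (mulVec_injective_of_rank_eq_card (H := H) (by rw [hrank, Fintype.card_fin]))
  have hρ' : (ρ : ℂ) ≠ 0 := Complex.ofReal_ne_zero.mpr hρ.ne'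
  have hpos : ∀ Q : Matrix (Fin nt) (Fin nt) ℂ, Q.PosSemidef →
      (1 + (ρ : ℂ) • (H * Q * Hᴴ) + C).PosDef := fun Q hQ =>
    (PosDef.one.add_posSemidef ((hQ.mul_mul_conjTranspose_same H).smul
      (Complex.zero_le_real.mpr hρ.le))).add_posSemidef hC
  have hAB : 1 + (ρ : ℂ) • (H * Q' * Hᴴ) + C ≠ 1 + (ρ : ℂ) • (H * Q'' * Hᴴ) + C := fun h =>
    hne (hinj (smul_right_injective _ hρ' (add_left_cancel (add_right_cancel h))))
  have hcomb : 1 + (ρ : ℂ) • (H * (l • Q' + (1 - l) • Q'') * Hᴴ) + C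
      = l • (1 + (ρ : ℂ) • (H * Q' * Hᴴ) + C)
        + (1 - l) • (1 + (ρ : ℂ) • (H * Q'' * Hᴴ) + C) := by
    simp only [Matrix.mul_add, Matrix.add_mul, Matrix.mul_smul, Matrix.smul_mul, smul_add,
      smul_comm (ρ : ℂ) (_ : ℝ)]
    module
  rw [hcomb]
  exact (hpos Q' hQ').log_det_re_strictConcave (hpos Q'' hQ'') hAB hl0 hl1
end
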